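/- arXiv:2511.12198 — 2 statements merged into one kernel-verified Lean document; each statement's English description precedes it below -/
import Mathlib

section
/- Let Λ be a finite-dimensional algebra over a field K. There exists an infinite semibrick in mod Λ if and only if there exists an infinite strictly increasing chain W1 ⊊ W2 ⊊ W3 ⊊ ⋯ of wide subcategories of mod Λ. -/
open Function DirectSum

namespace BrickPaper

variable (Λ : Type) [Ring Λ]

/-- `M` belongs to `mod Λ`, i.e. is a finitely generated module. -/
abbrev FG (M : ModuleCat.{0} Λ) : Prop := Module.Finite Λ M

/-- A class of modules closed under isomorphism. -/
def IsoClosed (C : Set (ModuleCat.{0} Λ)) : Prop :=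
  ∀ ⦃M N : ModuleCat.{0} Λ⦄, Nonempty (M ≃ₗ[Λ] N) → M ∈ C → N ∈ C

/-- A class of modules containing the zero modules. -/
def HasZeroObj (C : Set (ModuleCat.{0} Λ)) : Prop :=
  ∀ M : ModuleCat.{0} Λ, Subsingleton M → M ∈ C

/-- Closure under extensions: if `0 → A → M → B → 0` is exact with `A, B ∈ C` then `M ∈ C`. -/
def ExtClosed (C : Set (ModuleCat.{0} Λ)) : Prop :=
  ∀ ⦃A M B : ModuleCat.{0} Λ⦄ (f : A →ₗ[Λ] M) (g : M →ₗ[Λ] B),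
    Function.Injective f → Function.Surjective g →
    LinearMap.range f = LinearMap.ker g → A ∈ C → B ∈ C → M ∈ C

/-- Closure under quotients (images of surjections). -/
def QuotClosed (C : Set (ModuleCat.{0} Λ)) : Prop :=
  ∀ ⦃M N : ModuleCat.{0} Λ⦄ (g : M →ₗ[Λ] N), Function.Surjective g → M ∈ C → N ∈ C

/-- Closure under submodules (sources of injections). -/
def SubClosed (C : Set (ModuleCat.{0} Λ)) : Prop :=
  ∀ ⦃M N : ModuleCat.{0} Λ⦄ (f : M →ₗ[Λ] N), Function.Injective f → N ∈ C → M ∈ C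

/-- Closure under kernels of morphisms between members. -/
def KerClosed (C : Set (ModuleCat.{0} Λ)) : Prop :=
  ∀ ⦃M N : ModuleCat.{0} Λ⦄ (f : M →ₗ[Λ] N), M ∈ C → N ∈ C →
    ModuleCat.of Λ ↥(LinearMap.ker f) ∈ C

/-- Closure under cokernels of morphisms between members. -/
def CokerClosed (C : Set (ModuleCat.{0} Λ)) : Prop :=
  ∀ ⦃M N : ModuleCat.{0} Λ⦄ (f : M →ₗ[Λ] N), M ∈ C → N ∈ C →
    ModuleCat.of Λ ((N : Type) ⧸ LinearMap.range f) ∈ C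

/-- A wide subcategory of `mod Λ`: a class of finitely generated modules, closed under
isomorphisms, containing `0`, and closed under kernels, cokernels and extensions. -/
def IsWide (C : Set (ModuleCat.{0} Λ)) : Prop :=
  (∀ M ∈ C, FG Λ M) ∧ IsoClosed Λ C ∧ HasZeroObj Λ C ∧
    KerClosed Λ C ∧ CokerClosed Λ C ∧ ExtClosed Λ C

/-- A wide subcategory of the big module category `Mod Λ` (no finiteness condition). -/
def IsWideBig (C : Set (ModuleCat.{0} Λ)) : Prop :=
  IsoClosed Λ C ∧ HasZeroObj Λ C ∧ KerClosed Λ C ∧ CokerClosed Λ C ∧ ExtClosed Λ C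

/-- A torsion class in `mod Λ`: closed under quotients and extensions. -/
def IsTorsionClass (C : Set (ModuleCat.{0} Λ)) : Prop :=
  (∀ M ∈ C, FG Λ M) ∧ IsoClosed Λ C ∧ HasZeroObj Λ C ∧ QuotClosed Λ C ∧ ExtClosed Λ C

/-- A torsion-free class in `mod Λ`: closed under submodules and extensions. -/
def IsTorsionFreeClass (C : Set (ModuleCat.{0} Λ)) : Prop :=
  (∀ M ∈ C, FG Λ M) ∧ IsoClosed Λ C ∧ HasZeroObj Λ C ∧ SubClosed Λ C ∧ ExtClosed Λ C

/-- The smallest torsion class containing `X`. -/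
def torsClosure (X : Set (ModuleCat.{0} Λ)) : Set (ModuleCat.{0} Λ) :=
  ⋂₀ {C | IsTorsionClass Λ C ∧ X ⊆ C}

/-- The smallest torsion-free class containing `X`. -/
def torfClosure (X : Set (ModuleCat.{0} Λ)) : Set (ModuleCat.{0} Λ) :=
  ⋂₀ {C | IsTorsionFreeClass Λ C ∧ X ⊆ C}

/-- A widely generated torsion class. -/
def IsWidelyGenTors (T : Set (ModuleCat.{0} Λ)) : Prop :=
  IsTorsionClass Λ T ∧ ∃ W, IsWide Λ W ∧ T = torsClosure Λ W

/-- A widely generated torsion-free class. -/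
def IsWidelyGenTorf (F : Set (ModuleCat.{0} Λ)) : Prop :=
  IsTorsionFreeClass Λ F ∧ ∃ W, IsWide Λ W ∧ F = torfClosure Λ W

/-- A finitely generated torsion class: generated by a single module of `mod Λ`. -/
def IsFinGenTors (T : Set (ModuleCat.{0} Λ)) : Prop :=
  IsTorsionClass Λ T ∧ ∃ M : ModuleCat.{0} Λ, FG Λ M ∧ T = torsClosure Λ {M}

/-- `T' ` covers `T` in the poset of torsion classes. -/
def TorsCovers (T' T : Set (ModuleCat.{0} Λ)) : Prop :=
  IsTorsionClass Λ T' ∧ T ⊂ T' ∧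
    ∀ T'', IsTorsionClass Λ T'' → T ⊂ T'' → T'' ⊆ T' → T'' = T'

/-- `F'` covers `F` in the poset of torsion-free classes. -/
def TorfCovers (F' F : Set (ModuleCat.{0} Λ)) : Prop :=
  IsTorsionFreeClass Λ F' ∧ F ⊂ F' ∧
    ∀ F'', IsTorsionFreeClass Λ F'' → F ⊂ F'' → F'' ⊆ F' → F'' = F'

/-- A brick: a finitely generated module whose endomorphism ring is a division ring. -/
def IsBrick (M : ModuleCat.{0} Λ) : Prop :=
  FG Λ M ∧ Nontrivial M ∧ ∀ f : M →ₗ[Λ] M, f ≠ 0 → Function.Bijective f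

/-- A semibrick, regarded as an isomorphism-closed class of bricks (i.e. a set of
isomorphism classes of bricks) which are pairwise Hom-orthogonal. -/
def IsSemibrick (S : Set (ModuleCat.{0} Λ)) : Prop :=
  (∀ M ∈ S, IsBrick Λ M) ∧ IsoClosed Λ S ∧
    ∀ M ∈ S, ∀ N ∈ S, IsEmpty (M ≃ₗ[Λ] N) → ∀ f : M →ₗ[Λ] N, f = 0

/-- A monobrick, regarded as an isomorphism-closed class of bricks (i.e. a set of
isomorphism classes of bricks) such that every morphism between members is zero or injective. -/
def IsMonobrick (S : Set (ModuleCat.{0} Λ)) : Prop :=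
  (∀ M ∈ S, IsBrick Λ M) ∧ IsoClosed Λ S ∧
    ∀ M ∈ S, ∀ N ∈ S, ∀ f : M →ₗ[Λ] N, f = 0 ∨ Function.Injective f

/-- `N` is a cofinal extension of the monobrick `M`. -/
def IsCofinalExtension (M N : Set (ModuleCat.{0} Λ)) : Prop :=
  IsMonobrick Λ N ∧ M ⊆ N ∧
    ∀ X ∈ N, ∃ Y ∈ M, ∃ f : X →ₗ[Λ] Y, Function.Injective f

/-- A cofinally closed monobrick: a monobrick with no proper cofinal extension. -/
def IsCofinallyClosed (M : Set (ModuleCat.{0} Λ)) : Prop :=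
  IsMonobrick Λ M ∧ ∀ N, IsCofinalExtension Λ M N → N = M

/-- `S` contains only finitely many modules up to isomorphism. -/
def FiniteUpToIso (S : Set (ModuleCat.{0} Λ)) : Prop :=
  ∃ B : Set (ModuleCat.{0} Λ), B.Finite ∧ ∀ M ∈ S, ∃ N ∈ B, Nonempty (M ≃ₗ[Λ] N)

/-- `Λ` is brick-finite: there are only finitely many bricks up to isomorphism. -/
def BrickFinite : Prop := FiniteUpToIso Λ {M | IsBrick Λ M}

/-- Right Hom-perpendicular class `T^⊥` inside `mod Λ`. -/
def rPerp (T : Set (ModuleCat.{0} Λ)) : Set (ModuleCat.{0} Λ) :=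
  {M | FG Λ M ∧ ∀ X ∈ T, ∀ f : X →ₗ[Λ] M, f = 0}

/-- Left Hom-perpendicular class `^⊥F` inside `mod Λ`. -/
def lPerp (F : Set (ModuleCat.{0} Λ)) : Set (ModuleCat.{0} Λ) :=
  {M | FG Λ M ∧ ∀ Y ∈ F, ∀ f : M →ₗ[Λ] Y, f = 0}

/-- A minimal extending module for a torsion class `T`. -/
def IsMinExt (T : Set (ModuleCat.{0} Λ)) (M : ModuleCat.{0} Λ) : Prop :=
  FG Λ M ∧ Nontrivial M ∧
    (∀ S : Submodule Λ M, S ≠ ⊥ → ModuleCat.of Λ ((M : Type) ⧸ S) ∈ T) ∧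
    (∀ (X T' : ModuleCat.{0} Λ) (f : M →ₗ[Λ] X) (g : X →ₗ[Λ] T'),
      Function.Injective f → Function.Surjective g →
      LinearMap.range f = LinearMap.ker g → T' ∈ T →
      (¬ ∃ r : X →ₗ[Λ] M, r ∘ₗ f = LinearMap.id) → X ∈ T) ∧
    (∀ X ∈ T, ∀ f : X →ₗ[Λ] M, f = 0)

/-- A minimal co-extending module for a torsion-free class `F`. -/
def IsMinCoext (F : Set (ModuleCat.{0} Λ)) (M : ModuleCat.{0} Λ) : Prop :=
  FG Λ M ∧ Nontrivial M ∧
    (∀ S : Submodule Λ M, S ≠ ⊤ → ModuleCat.of Λ ↥S ∈ F) ∧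
    (∀ (X F' : ModuleCat.{0} Λ) (f : F' →ₗ[Λ] X) (g : X →ₗ[Λ] M),
      Function.Injective f → Function.Surjective g →
      LinearMap.range f = LinearMap.ker g → F' ∈ F →
      (¬ ∃ s : M →ₗ[Λ] X, g ∘ₗ s = LinearMap.id) → X ∈ F) ∧
    (∀ Y ∈ F, ∀ f : M →ₗ[Λ] Y, f = 0)

/-- The set (of representatives of isomorphism classes) of minimal extending modules. -/
def ME (T : Set (ModuleCat.{0} Λ)) : Set (ModuleCat.{0} Λ) := {M | IsMinExt Λ T M}

/-- The set (of representatives of isomorphism classes) of minimal co-extending modules. -/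
def MCE (F : Set (ModuleCat.{0} Λ)) : Set (ModuleCat.{0} Λ) := {M | IsMinCoext Λ F M}

/-- `M` admits a finite filtration with subquotients isomorphic to members of `B`. -/
def FiltMem (B : Set (ModuleCat.{0} Λ)) (M : ModuleCat.{0} Λ) : Prop :=
  ∃ (n : ℕ) (c : Fin (n + 1) → Submodule Λ M), Monotone c ∧ c 0 = ⊥ ∧ c (Fin.last n) = ⊤ ∧
    ∀ i : Fin n, ∃ N ∈ B,
      Nonempty ((↥(c i.succ) ⧸ Submodule.comap (c i.succ).subtype (c i.castSucc)) ≃ₗ[Λ] N)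

/-- `Filt B`. -/
def filtClosure (B : Set (ModuleCat.{0} Λ)) : Set (ModuleCat.{0} Λ) :=
  {M | FiltMem Λ B M}

/-- The simple objects of a subcategory `C`, i.e. nonzero members with no proper nonzero
subobject belonging to `C`. -/
def simOf (C : Set (ModuleCat.{0} Λ)) : Set (ModuleCat.{0} Λ) :=
  {M | M ∈ C ∧ Nontrivial M ∧
    ∀ (X : ModuleCat.{0} Λ) (f : X →ₗ[Λ] M), X ∈ C → Function.Injective f →
      LinearMap.range f = ⊥ ∨ LinearMap.range f = ⊤}

/-- The subcategory `α(T) = {X ∈ T : for all g : Y → X with Y ∈ T, ker g ∈ T}`. -/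
def alphaOf (T : Set (ModuleCat.{0} Λ)) : Set (ModuleCat.{0} Λ) :=
  {X | X ∈ T ∧ ∀ (Y : ModuleCat.{0} Λ) (g : Y →ₗ[Λ] X), Y ∈ T →
    ModuleCat.of Λ ↥(LinearMap.ker g) ∈ T}

/-- Covariantly finite subcategory of `mod Λ`. -/
def CovariantlyFinite (B : Set (ModuleCat.{0} Λ)) : Prop :=
  ∀ M : ModuleCat.{0} Λ, FG Λ M → ∃ N ∈ B, ∃ f : M →ₗ[Λ] N,
    ∀ N' ∈ B, ∀ g : M →ₗ[Λ] N', ∃ h : N →ₗ[Λ] N', h ∘ₗ f = g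

/-- Contravariantly finite subcategory of `mod Λ`. -/
def ContravariantlyFinite (B : Set (ModuleCat.{0} Λ)) : Prop :=
  ∀ M : ModuleCat.{0} Λ, FG Λ M → ∃ N ∈ B, ∃ f : N →ₗ[Λ] M,
    ∀ N' ∈ B, ∀ g : N' →ₗ[Λ] M, ∃ h : N' →ₗ[Λ] N, f ∘ₗ h = g

/-- Functorially finite subcategory of `mod Λ`. -/
def FunctoriallyFinite (B : Set (ModuleCat.{0} Λ)) : Prop :=
  CovariantlyFinite Λ B ∧ ContravariantlyFinite Λ B

/-- Closure under (set-indexed) coproducts. -/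
def CoprodClosed (C : Set (ModuleCat.{0} Λ)) : Prop :=
  ∀ (ι : Type) (M : ι → ModuleCat.{0} Λ), (∀ i, M i ∈ C) →
    ModuleCat.of Λ (⨁ i, (M i : Type)) ∈ C

/-- Closure under (set-indexed) products. -/
def ProdClosed (C : Set (ModuleCat.{0} Λ)) : Prop :=
  ∀ (ι : Type) (M : ι → ModuleCat.{0} Λ), (∀ i, M i ∈ C) →
    ModuleCat.of Λ ((i : ι) → (M i : Type)) ∈ C

/-! Lattice-theoretic notions in the complete lattice of torsion classes. -/

/-- The join of a set of torsion classes. -/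
def torsJoin (X : Set (Set (ModuleCat.{0} Λ))) : Set (ModuleCat.{0} Λ) :=
  torsClosure Λ (⋃₀ X)

/-- The meet of a set of torsion classes (inside the lattice of torsion classes,
whose top element is `mod Λ`). -/
def torsMeet (X : Set (Set (ModuleCat.{0} Λ))) : Set (ModuleCat.{0} Λ) :=
  {M | FG Λ M} ∩ ⋂₀ X

/-- A completely join-irreducible torsion class. -/
def CompletelyJoinIrred (J : Set (ModuleCat.{0} Λ)) : Prop :=
  IsTorsionClass Λ J ∧
    ∀ X : Set (Set (ModuleCat.{0} Λ)), (∀ a ∈ X, IsTorsionClass Λ a) →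
      torsJoin Λ X = J → J ∈ X

/-- `J_* = ⋁ {x : x < J}`. -/
def jstar (J : Set (ModuleCat.{0} Λ)) : Set (ModuleCat.{0} Λ) :=
  torsJoin Λ {C | IsTorsionClass Λ C ∧ C ⊂ J}

/-- `k = κ(J) = max {x : J ∧ x = J_*}`. -/
def IsKappa (J k : Set (ModuleCat.{0} Λ)) : Prop :=
  IsTorsionClass Λ k ∧ J ∩ k = jstar Λ J ∧
    ∀ C, IsTorsionClass Λ C → J ∩ C = jstar Λ J → C ⊆ k

/-- `A` is a join representation of the torsion class `T`. -/
def IsJoinRep (T : Set (ModuleCat.{0} Λ)) (A : Set (Set (ModuleCat.{0} Λ))) : Prop :=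
  (∀ a ∈ A, IsTorsionClass Λ a) ∧ torsJoin Λ A = T

/-- `A` refines `B`. -/
def Refines (A B : Set (Set (ModuleCat.{0} Λ))) : Prop :=
  ∀ a ∈ A, ∃ b ∈ B, a ⊆ b

/-- `A` is the canonical join representation of `T`. -/
def IsCJR (T : Set (ModuleCat.{0} Λ)) (A : Set (Set (ModuleCat.{0} Λ))) : Prop :=
  IsJoinRep Λ T A ∧ (∀ B, IsJoinRep Λ T B → Refines Λ A B) ∧
    ∀ a ∈ A, ∀ b ∈ A, a ⊆ b → a = b

/-- `Kb = κ̄(T) = ⋀ {κ(j) : j ∈ CJR(T)}`, the extended kappa map. -/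
def IsKappaBar (T Kb : Set (ModuleCat.{0} Λ)) : Prop :=
  ∃ A, IsCJR Λ T A ∧ (∀ j ∈ A, CompletelyJoinIrred Λ j) ∧
    (∀ j ∈ A, ∃ k, IsKappa Λ j k) ∧
    Kb = torsMeet Λ {k | ∃ j ∈ A, IsKappa Λ j k}

/-- The kappa order: `a ≤_κ b` iff `a ≤ b` and `κ̄(a) ≥ κ̄(b)`. -/
def KappaLE (a b : Set (ModuleCat.{0} Λ)) : Prop :=
  a ⊆ b ∧ ∀ Ka Kb, IsKappaBar Λ a Ka → IsKappaBar Λ b Kb → Kb ⊆ Ka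

section Filtration

variable {Λ}

/-- Modules admitting a finite filtration with subquotients in `S`, built up from the bottom. -/
inductive Filt (S : Set (ModuleCat.{0} Λ)) : ModuleCat.{0} Λ → Prop
  | zero (M : ModuleCat.{0} Λ) (h : Subsingleton M) : Filt S M
  | step {B M M' : ModuleCat.{0} Λ} (i : B →ₗ[Λ] M) (p : M →ₗ[Λ] M') (hi : Injective i)
      (hp : Surjective p) (hip : LinearMap.range i = LinearMap.ker p) (hB : B ∈ S)
      (hM' : Filt S M') : Filt S M

variable {S T : Set (ModuleCat.{0} Λ)}

theorem Filt.mono (hST : S ⊆ T) {M : ModuleCat.{0} Λ} (h : Filt S M) : Filt T M := by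
  induction h with
  | zero M h => exact .zero M h
  | step i p hi hp hip hB _ ih => exact .step i p hi hp hip (hST hB) ih

theorem Filt.of_equiv {M N : ModuleCat.{0} Λ} (e : M ≃ₗ[Λ] N) (h : Filt S M) : Filt S N := by
  cases h with
  | zero _ h => exact .zero N e.symm.toEquiv.subsingleton
  | step i p hi hp hip hB hM' =>
    refine .step (e.toLinearMap ∘ₗ i) (p ∘ₗ e.symm.toLinearMap) (e.injective.comp hi)
      (hp.comp e.symm.surjective) ?_ hB hM'
    ext x
    have := SetLike.ext_iff.1 hip (e.symm x)
    simp only [LinearMap.mem_range, LinearMap.mem_ker, LinearMap.comp_apply,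
      LinearEquiv.coe_coe] at this ⊢
    rw [← this]
    exact exists_congr fun y => (LinearEquiv.eq_symm_apply e).symm

theorem Filt.of_mem {M : ModuleCat.{0} Λ} (h : M ∈ S) : Filt S M :=
  .step (M' := ModuleCat.of Λ PUnit) LinearMap.id 0 injective_id
    (fun _ => ⟨0, rfl⟩) (by simp) h (.zero _ (inferInstanceAs (Subsingleton PUnit)))

theorem Filt.finite (hS : ∀ M ∈ S, FG Λ M) {M : ModuleCat.{0} Λ} (h : Filt S M) : FG Λ M := by
  induction h with
  | zero M h => exact inferInstance
  | step i p hi hp hip hB _ ih =>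
    have := hS _ hB
    refine ⟨Submodule.fg_of_fg_map_of_fg_inf_ker p ?_ ?_⟩
    · rw [Submodule.map_top, LinearMap.range_eq_top.2 hp]
      exact ih.fg_top
    · rw [top_inf_eq, ← hip]
      exact (Module.Finite.iff_fg.1 inferInstance)

theorem Filt.extension {A M C : ModuleCat.{0} Λ} (f : A →ₗ[Λ] M) (g : M →ₗ[Λ] C)
    (hf : Injective f) (hg : Surjective g) (hfg : LinearMap.range f = LinearMap.ker g)
    (hA : Filt S A) (hC : Filt S C) : Filt S M := by
  induction hA generalizing M with
  | zero A h =>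
    refine hC.of_equiv (LinearEquiv.ofBijective g ⟨?_, hg⟩).symm
    rw [← LinearMap.ker_eq_bot, ← hfg, LinearMap.range_eq_bot]
    exact Subsingleton.elim _ _
  | @step B A A' i p hi hp hip hB _ ih =>
    have hex (x) : g x = 0 ↔ ∃ y, f y = x := (SetLike.ext_iff.1 hfg x).symm
    have hexp (x) : p x = 0 ↔ ∃ y, i y = x := (SetLike.ext_iff.1 hip x).symm
    let R := LinearMap.range (f ∘ₗ i)
    have hR : R ≤ LinearMap.ker g := by
      rintro _ ⟨x, rfl⟩
      exact (hex _).2 ⟨i x, rfl⟩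
    let e : (A ⧸ LinearMap.ker p) ≃ₗ[Λ] A' := p.quotKerEquivOfSurjective hp
    let u : (A ⧸ LinearMap.ker p) →ₗ[Λ] (M ⧸ R) := Submodule.mapQ _ _ f (by
      rw [← hip]
      rintro _ ⟨x, rfl⟩
      exact ⟨x, rfl⟩)
    have he (x) : e.symm (p x) = Submodule.Quotient.mk x := by
      rw [LinearEquiv.symm_apply_eq]; rfl
    refine .step (M' := ModuleCat.of Λ (M ⧸ R)) (f ∘ₗ i) R.mkQ (hf.comp hi) R.mkQ_surjective
      R.ker_mkQ.symm hB (ih (u ∘ₗ e.symm.toLinearMap) (R.liftQ g hR) ?_ ?_ ?_)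
    · refine (injective_iff_map_eq_zero _).2 fun x hx => ?_
      obtain ⟨a, rfl⟩ := hp x
      have h1 : u (e.symm (p a)) = 0 := hx
      rw [he] at h1
      obtain ⟨b, hb⟩ := (Submodule.Quotient.mk_eq_zero R).1 h1
      exact (hexp a).2 ⟨b, hf hb⟩
    · intro c
      obtain ⟨m, rfl⟩ := hg c
      exact ⟨Submodule.Quotient.mk m, rfl⟩
    · ext x
      obtain ⟨m, rfl⟩ := R.mkQ_surjective x
      constructor
      · rintro ⟨y, hy⟩
        obtain ⟨a, rfl⟩ := hp y
        have h1 : u (e.symm (p a)) = R.mkQ m := hy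
        rw [he] at h1
        rw [← h1]
        exact (hex _).2 ⟨a, rfl⟩
      · intro h
        obtain ⟨a, rfl⟩ := (hex m).1 h
        refine ⟨p a, ?_⟩
        change u (e.symm (p a)) = _
        rw [he]
        rfl

/-- A nonzero map from a member of a semibrick to a filtered module is injective with filtered
cokernel. -/
theorem Filt.injective_and_coker (hS : IsSemibrick Λ S) {C M : ModuleCat.{0} Λ} (hC : C ∈ S)
    (hM : Filt S M) (f : C →ₗ[Λ] M) (hf : f ≠ 0) :
    Injective f ∧ ∀ (Q : ModuleCat.{0} Λ) (q : M →ₗ[Λ] Q), Surjective q →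
      LinearMap.ker q = LinearMap.range f → Filt S Q := by
  induction hM with
  | zero M h => exact absurd (Subsingleton.elim _ _) hf
  | @step B M M' i p hi hp hip hB hM' ih =>
    have hexp (x) : p x = 0 ↔ ∃ y, i y = x := (SetLike.ext_iff.1 hip x).symm
    by_cases hpf : p ∘ₗ f = 0
    · have hfr : ∀ c, f c ∈ LinearMap.range i := fun c => by
        rw [hip]; exact LinearMap.congr_fun hpf c
      let g : C →ₗ[Λ] B := (LinearEquiv.ofInjective i hi).symm.toLinearMap ∘ₗ f.codRestrict _ hfr
      have hg (c) : i (g c) = f c :=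
        congrArg Subtype.val ((LinearEquiv.ofInjective i hi).apply_symm_apply ⟨f c, hfr c⟩)
      have hg0 : g ≠ 0 := by
        rintro h
        refine hf (LinearMap.ext fun c => ?_)
        rw [← hg, h]; simp
      have hgb : Bijective g := by
        by_cases hne : Nonempty (C ≃ₗ[Λ] B)
        · obtain ⟨e⟩ := hne
          have := (hS.1 C hC).2.2 (e.symm.toLinearMap ∘ₗ g) (fun h => hg0 (LinearMap.ext fun c =>
            e.symm.injective (by simpa using LinearMap.congr_fun h c)))
          exact (e.symm.bijective.of_comp_iff' g).1 this
        · exact absurd (hS.2.2 C hC B hB (not_nonempty_iff.1 hne) g) hg0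
      refine ⟨fun a b hab => hgb.1 (hi (by rw [hg, hg, hab])), fun Q q hq hqf => ?_⟩
      have hker : LinearMap.ker p = LinearMap.ker q := by
        rw [hqf, ← hip]
        ext x
        constructor
        · rintro ⟨b, rfl⟩
          obtain ⟨c, rfl⟩ := hgb.2 b
          exact ⟨c, (hg c).symm⟩
        · rintro ⟨c, rfl⟩
          exact ⟨g c, hg c⟩
      exact hM'.of_equiv ((p.quotKerEquivOfSurjective hp).symm.trans
        ((Submodule.quotEquivOfEq _ _ hker).trans (q.quotKerEquivOfSurjective hq)))
    · obtain ⟨hinj, hcok⟩ := ih (p ∘ₗ f) hpf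
      refine ⟨Injective.of_comp (f := p) hinj, fun Q q hq hqf => ?_⟩
      have hexq (x) : q x = 0 ↔ ∃ y, f y = x := SetLike.ext_iff.1 hqf x
      let R := LinearMap.range (p ∘ₗ f)
      have hle : LinearMap.ker q ≤ LinearMap.ker (R.mkQ ∘ₗ p) := by
        rw [hqf]
        rintro _ ⟨c, rfl⟩
        exact (Submodule.Quotient.mk_eq_zero R).2 ⟨c, rfl⟩
      let e := q.quotKerEquivOfSurjective hq
      have he (x) : e.symm (q x) = Submodule.Quotient.mk x := by
        rw [LinearEquiv.symm_apply_eq]; rfl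
      let r : Q →ₗ[Λ] (M' ⧸ R) := (LinearMap.ker q).liftQ (R.mkQ ∘ₗ p) hle ∘ₗ e.symm.toLinearMap
      have hr (x) : r (q x) = R.mkQ (p x) := by
        change (LinearMap.ker q).liftQ (R.mkQ ∘ₗ p) hle (e.symm (q x)) = _
        rw [he]; rfl
      refine .step (M' := ModuleCat.of Λ (M' ⧸ R)) (q ∘ₗ i) r ?_ ?_ ?_ hB
        (hcok _ R.mkQ R.mkQ_surjective R.ker_mkQ)
      · refine (injective_iff_map_eq_zero _).2 fun b hb => ?_
        obtain ⟨c, hc⟩ := (hexq _).1 hb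
        have : c = 0 := hinj (by simpa [hc] using (hexp _).2 ⟨b, rfl⟩)
        exact hi (by rw [← hc, this, map_zero, map_zero])
      · intro y
        obtain ⟨m', rfl⟩ := R.mkQ_surjective y
        obtain ⟨m, rfl⟩ := hp m'
        exact ⟨q m, hr m⟩
      · ext x
        obtain ⟨m, rfl⟩ := hq x
        rw [LinearMap.mem_ker, hr]
        constructor
        · rintro ⟨b, hb⟩
          obtain ⟨c, hc⟩ := (hexq (i b - m)).1 (by rw [map_sub, sub_eq_zero]; exact hb)
          refine (Submodule.Quotient.mk_eq_zero R).2 ⟨-c, ?_⟩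
          simp [hc, (hexp (i b)).2 ⟨b, rfl⟩]
        · intro h
          obtain ⟨c, hc⟩ := (Submodule.Quotient.mk_eq_zero R).1 h
          obtain ⟨b, hb⟩ := (hexp (m - f c)).1 (by rw [map_sub, sub_eq_zero]; exact hc.symm)
          exact ⟨b, by simp [hb, (hexq (f c)).2 ⟨c, rfl⟩]⟩

theorem Filt.ker_and_coker (hS : IsSemibrick Λ S) {M : ModuleCat.{0} Λ} (hM : Filt S M) :
    ∀ {N : ModuleCat.{0} Λ} (_ : Filt S N) (f : M →ₗ[Λ] N),
      (∀ (L : ModuleCat.{0} Λ) (k : L →ₗ[Λ] M), Injective k →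
        LinearMap.range k = LinearMap.ker f → Filt S L) ∧
      ∀ (Q : ModuleCat.{0} Λ) (q : N →ₗ[Λ] Q), Surjective q →
        LinearMap.ker q = LinearMap.range f → Filt S Q := by
  induction hM with
  | zero M h =>
    intro N hN f
    refine ⟨fun L k hk _ => .zero L hk.subsingleton, fun Q q hq hqf => ?_⟩
    refine hN.of_equiv (LinearEquiv.ofBijective q ⟨?_, hq⟩)
    rw [← LinearMap.ker_eq_bot, hqf, LinearMap.range_eq_bot]
    exact Subsingleton.elim _ _
  | @step B M M' i p hi hp hip hB hM' ih =>
    intro N hN f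
    have hexp (x) : p x = 0 ↔ ∃ y, i y = x := (SetLike.ext_iff.1 hip x).symm
    let e := p.quotKerEquivOfSurjective hp
    have he (x) : e.symm (p x) = Submodule.Quotient.mk x := by
      rw [LinearEquiv.symm_apply_eq]; rfl
    by_cases hfi : f ∘ₗ i = 0
    · have hle : LinearMap.ker p ≤ LinearMap.ker f := by
        rw [← hip]
        rintro _ ⟨b, rfl⟩
        exact LinearMap.congr_fun hfi b
      let f' : M' →ₗ[Λ] N := (LinearMap.ker p).liftQ f hle ∘ₗ e.symm.toLinearMap
      have hf' (x) : f' (p x) = f x := by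
        change (LinearMap.ker p).liftQ f hle (e.symm (p x)) = _
        rw [he]; rfl
      obtain ⟨hk', hc'⟩ := ih hN f'
      refine ⟨fun L k hk hkf => ?_, fun Q q hq hqf => hc' Q q hq ?_⟩
      · have hexk (x) : f x = 0 ↔ ∃ y, k y = x := (SetLike.ext_iff.1 hkf x).symm
        have hir : ∀ b, i b ∈ LinearMap.range k := fun b => by
          rw [hkf]; exact LinearMap.congr_fun hfi b
        let j : B →ₗ[Λ] L :=
          (LinearEquiv.ofInjective k hk).symm.toLinearMap ∘ₗ i.codRestrict _ hir
        have hj (b) : k (j b) = i b :=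
          congrArg Subtype.val ((LinearEquiv.ofInjective k hk).apply_symm_apply ⟨i b, hir b⟩)
        have hpk : ∀ l, p (k l) ∈ LinearMap.ker f' := fun l => by
          rw [LinearMap.mem_ker, hf']; exact (hexk _).2 ⟨l, rfl⟩
        refine .step (M' := ModuleCat.of Λ (LinearMap.ker f')) j
          ((p ∘ₗ k).codRestrict (LinearMap.ker f') hpk) ?_ ?_ ?_ hB
          (hk' _ (LinearMap.ker f').subtype Subtype.val_injective (Submodule.range_subtype _))
        · exact fun a b hab => hi (by rw [← hj, ← hj, hab])
        · rintro ⟨y, hy⟩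
          obtain ⟨m, rfl⟩ := hp y
          rw [LinearMap.mem_ker, hf'] at hy
          obtain ⟨l, rfl⟩ := (hexk m).1 hy
          exact ⟨l, rfl⟩
        · ext l
          rw [LinearMap.mem_ker, Subtype.ext_iff]
          change _ ↔ p (k l) = 0
          rw [hexp]
          exact exists_congr fun b => by rw [← hj, hk.eq_iff]
      · rw [hqf]
        ext y
        constructor
        · rintro ⟨m, rfl⟩
          exact ⟨p m, hf' m⟩
        · rintro ⟨m', rfl⟩
          obtain ⟨m, rfl⟩ := hp m'
          exact ⟨m, (hf' m).symm⟩
    · obtain ⟨hinj, hcok⟩ := hN.injective_and_coker hS hB (f ∘ₗ i) hfi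
      let R := LinearMap.range (f ∘ₗ i)
      have hle : LinearMap.ker p ≤ LinearMap.ker (R.mkQ ∘ₗ f) := by
        rw [← hip]
        rintro _ ⟨b, rfl⟩
        exact (Submodule.Quotient.mk_eq_zero R).2 ⟨b, rfl⟩
      let f' : M' →ₗ[Λ] (N ⧸ R) := (LinearMap.ker p).liftQ (R.mkQ ∘ₗ f) hle ∘ₗ e.symm.toLinearMap
      have hf' (x) : f' (p x) = R.mkQ (f x) := by
        change (LinearMap.ker p).liftQ (R.mkQ ∘ₗ f) hle (e.symm (p x)) = _
        rw [he]; rfl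
      obtain ⟨hk', hc'⟩ := ih (N := ModuleCat.of Λ (N ⧸ R))
        (hcok _ R.mkQ R.mkQ_surjective R.ker_mkQ) f'
      refine ⟨fun L k hk hkf => hk' L (p ∘ₗ k) ?_ ?_, fun Q q hq hqf => ?_⟩
      · have hexk (x) : f x = 0 ↔ ∃ y, k y = x := (SetLike.ext_iff.1 hkf x).symm
        refine (injective_iff_map_eq_zero _).2 fun l hl => ?_
        obtain ⟨b, hb⟩ := (hexp _).1 hl
        have : b = 0 := hinj (by simpa [hb] using (hexk _).2 ⟨l, rfl⟩)
        exact hk (by rw [← hb, this, map_zero, map_zero])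
      · have hexk (x) : f x = 0 ↔ ∃ y, k y = x := (SetLike.ext_iff.1 hkf x).symm
        ext y
        obtain ⟨m, rfl⟩ := hp y
        rw [LinearMap.mem_ker, hf']
        constructor
        · rintro ⟨l, hl⟩
          obtain ⟨b, hb⟩ := (hexp (m - k l)).1 (by rw [map_sub, sub_eq_zero]; exact hl.symm)
          exact (Submodule.Quotient.mk_eq_zero R).2
            ⟨b, by simp [hb, (hexk (k l)).2 ⟨l, rfl⟩]⟩
        · intro h
          obtain ⟨b, hb⟩ := (Submodule.Quotient.mk_eq_zero R).1 h
          obtain ⟨l, hl⟩ := (hexk (m - i b)).1 (by rw [map_sub, sub_eq_zero]; exact hb.symm)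
          exact ⟨l, by simp [hl, (hexp (i b)).2 ⟨b, rfl⟩]⟩
      · have hRq : R ≤ LinearMap.ker q := by
          rw [hqf]
          rintro _ ⟨b, rfl⟩
          exact ⟨i b, rfl⟩
        refine hc' Q (R.liftQ q hRq) ?_ ?_
        · intro y
          obtain ⟨n, rfl⟩ := hq y
          exact ⟨Submodule.Quotient.mk n, rfl⟩
        · ext x
          obtain ⟨n, rfl⟩ := R.mkQ_surjective x
          have hexq : q n = 0 ↔ ∃ y, f y = n := SetLike.ext_iff.1 hqf n
          change q n = 0 ↔ _
          rw [hexq]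
          constructor
          · rintro ⟨m, rfl⟩
            exact ⟨p m, hf' m⟩
          · rintro ⟨m', hm'⟩
            obtain ⟨m, rfl⟩ := hp m'
            rw [hf'] at hm'
            obtain ⟨b, hb⟩ := (Submodule.Quotient.eq R).1 hm'
            refine ⟨m - i b, ?_⟩
            rw [map_sub, sub_eq_iff_eq_add, ← sub_eq_iff_eq_add']
            exact hb.symm

theorem isWide_filt (hS : IsSemibrick Λ S) : IsWide Λ {M | Filt S M} :=
  ⟨fun _ hM => hM.finite fun B hB => (hS.1 B hB).1, fun _ _ ⟨e⟩ hM => hM.of_equiv e,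
    fun M hM => .zero M hM,
    fun _ _ f hM hN => (Filt.ker_and_coker hS hM hN f).1 _ (LinearMap.ker f).subtype
      Subtype.val_injective (Submodule.range_subtype _),
    fun _ _ f hM hN => (Filt.ker_and_coker hS hM hN f).2 _ (LinearMap.range f).mkQ
      (Submodule.mkQ_surjective _) (Submodule.ker_mkQ _),
    fun _ _ _ f g hf hg hfg hA hB => Filt.extension f g hf hg hfg hA hB⟩

theorem IsSemibrick.subset (hS : IsSemibrick Λ S) (hTS : T ⊆ S) (hT : IsoClosed Λ T) :
    IsSemibrick Λ T :=
  ⟨fun M hM => hS.1 M (hTS hM), hT, fun M hM N hN => hS.2.2 M (hTS hM) N (hTS hN)⟩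

theorem exists_seq_of_not_finiteUpToIso (h : ¬ FiniteUpToIso Λ S) :
    ∃ B : ℕ → ModuleCat.{0} Λ, (∀ n, B n ∈ S) ∧ ∀ m n, m < n → IsEmpty (B n ≃ₗ[Λ] B m) := by
  refine exists_seq_of_forall_finset_exists (· ∈ S) (fun M N => IsEmpty (N ≃ₗ[Λ] M))
    fun s _ => ?_
  by_contra! hs
  refine h ⟨s, s.finite_toSet, fun M hM => ?_⟩
  obtain ⟨N, hN, hMN⟩ := hs M hM
  exact ⟨N, hN, by simpa using hMN⟩

theorem exists_strict_wide_chain (hS : IsSemibrick Λ S) (h : ¬ FiniteUpToIso Λ S) :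
    ∃ W : ℕ → Set (ModuleCat.{0} Λ), (∀ n, IsWide Λ (W n)) ∧ ∀ n, W n ⊂ W (n + 1) := by
  obtain ⟨B, hB, hne⟩ := exists_seq_of_not_finiteUpToIso h
  let T : ℕ → Set (ModuleCat.{0} Λ) := fun n => {M | ∃ i < n, Nonempty (B i ≃ₗ[Λ] M)}
  have hTS (n) : T n ⊆ S := fun M ⟨i, _, e⟩ => hS.2.1 e (hB i)
  have hT (n) : IsSemibrick Λ (T n) :=
    hS.subset (hTS n) fun M N ⟨e⟩ ⟨i, hi, ⟨e'⟩⟩ => ⟨i, hi, ⟨e'.trans e⟩⟩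
  have hTmono (n) : T n ⊆ T (n + 1) := fun M ⟨i, hi, e⟩ => ⟨i, by omega, e⟩
  refine ⟨fun n => {M | Filt (T n) M}, fun n => isWide_filt (hT n), fun n =>
    ⟨fun M hM => hM.mono (hTmono n), fun hle => ?_⟩⟩
  have hBn : Filt (T n) (B n) :=
    hle (Filt.of_mem ⟨n, n.lt_succ_self, ⟨LinearEquiv.refl Λ (B n)⟩⟩)
  have hnt := (hS.1 _ (hB n)).2.1
  generalize hX : B n = X at hBn
  cases hBn with
  | zero _ h =>
    subst hX
    exact not_subsingleton _ h
  | @step C _ _ i p hi _ _ hC _ =>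
    subst hX
    have hCnt := (hS.1 _ (hTS n hC)).2.1
    have hi0 : i = 0 := by
      refine hS.2.2 _ (hTS n hC) _ (hB n) ⟨fun e => ?_⟩ i
      obtain ⟨m, hm, ⟨e'⟩⟩ := hC
      exact (hne m n hm).false (e'.trans e).symm
    obtain ⟨x, hx⟩ := exists_ne (0 : C)
    exact hx (hi (by simp [hi0]))

end Filtration

section Simples

variable {Λ} {U V : Set (ModuleCat.{0} Λ)}

theorem IsWide.range_mem (hU : IsWide Λ U) {M N : ModuleCat.{0} Λ} (hM : M ∈ U) (hN : N ∈ U)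
    (f : M →ₗ[Λ] N) : ModuleCat.of Λ (LinearMap.range f) ∈ U := by
  have h := hU.2.2.2.1 (N := ModuleCat.of Λ (N ⧸ LinearMap.range f)) (LinearMap.range f).mkQ hN
    (hU.2.2.2.2.1 f hM hN)
  exact hU.2.1 ⟨LinearEquiv.ofEq _ _ (Submodule.ker_mkQ _)⟩ h

theorem IsWide.bijective_of_simOf (hU : IsWide Λ U) {M N : ModuleCat.{0} Λ}
    (hM : M ∈ simOf Λ U) (hN : N ∈ simOf Λ U) (f : M →ₗ[Λ] N) (hf : f ≠ 0) : Bijective f := by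
  constructor
  · rcases hM.2.2 (ModuleCat.of Λ (LinearMap.ker f)) (LinearMap.ker f).subtype
      (hU.2.2.2.1 f hM.1 hN.1) Subtype.val_injective with h | h
    · rw [Submodule.range_subtype] at h
      exact LinearMap.ker_eq_bot.1 h
    · rw [Submodule.range_subtype] at h
      exact absurd (LinearMap.ker_eq_top.1 h) hf
  · rcases hN.2.2 (ModuleCat.of Λ (LinearMap.range f)) (LinearMap.range f).subtype
      (hU.range_mem hM.1 hN.1 f) Subtype.val_injective with h | h
    · rw [Submodule.range_subtype] at h
      exact absurd (LinearMap.range_eq_bot.1 h) hf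
    · rw [Submodule.range_subtype] at h
      exact LinearMap.range_eq_top.1 h

theorem IsWide.isSemibrick_simOf (hU : IsWide Λ U) : IsSemibrick Λ (simOf Λ U) := by
  refine ⟨fun M hM => ⟨hU.1 M hM.1, hM.2.1, hU.bijective_of_simOf hM hM⟩, ?_,
    fun M hM N hN hMN f => ?_⟩
  · rintro M N ⟨e⟩ hM
    have := hM.2.1
    refine ⟨hU.2.1 ⟨e⟩ hM.1, e.symm.toEquiv.nontrivial, fun X f hX hf => ?_⟩
    have h := hM.2.2 X (e.symm.toLinearMap ∘ₗ f) hX (e.symm.injective.comp hf)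
    rw [LinearMap.range_comp] at h
    refine h.imp (fun h => ?_) fun h => ?_
    · exact (Submodule.map_eq_bot_iff (e := e.symm)).1 h
    · apply Submodule.map_injective_of_injective e.symm.injective
      rw [h, Submodule.map_top, LinearEquiv.range]
  · by_contra hf
    exact hMN.false (LinearEquiv.ofBijective f (hU.bijective_of_simOf hM hN f hf))

theorem IsWide.exists_submodule_mem_simOf [IsArtinianRing Λ] (hU : IsWide Λ U)
    {M : ModuleCat.{0} Λ} (hM : M ∈ U) (hnt : Nontrivial M) :
    ∃ T : Submodule Λ M, T ≠ ⊥ ∧ ModuleCat.of Λ T ∈ simOf Λ U := by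
  have : Module.Finite Λ M := hU.1 M hM
  obtain ⟨T, ⟨hT0, hTU⟩, hmin⟩ := WellFounded.has_min (wellFounded_lt (α := Submodule Λ M))
    {T | T ≠ ⊥ ∧ ModuleCat.of Λ T ∈ U}
    ⟨⊤, top_ne_bot, hU.2.1 ⟨(Submodule.topEquiv (R := Λ) (M := M)).symm⟩ hM⟩
  refine ⟨T, hT0, hTU, Submodule.nontrivial_iff_ne_bot.2 hT0, fun X f hX hf => ?_⟩
  let P : Submodule Λ M := LinearMap.range (T.subtype ∘ₗ f)
  have hPT : P ≤ T := by
    rintro _ ⟨x, rfl⟩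
    exact (f x).2
  have hPU : ModuleCat.of Λ P ∈ U :=
    hU.2.1 ⟨LinearEquiv.ofInjective (T.subtype ∘ₗ f) (Subtype.val_injective.comp hf)⟩ hX
  by_cases hP : P = ⊥
  · left
    refine LinearMap.range_eq_bot.2 (LinearMap.ext fun x => Subtype.ext ?_)
    exact LinearMap.congr_fun (LinearMap.range_eq_bot.1 hP) x
  · right
    have hPeq : P = T := by
      by_contra hne
      exact hmin P ⟨hP, hPU⟩ (lt_of_le_of_ne hPT hne)
    refine LinearMap.range_eq_top.2 fun t => ?_
    obtain ⟨x, hx⟩ : (t : M) ∈ P := hPeq.ge t.2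
    exact ⟨x, Subtype.ext hx⟩

theorem IsWide.subset_of_simOf_subset [IsArtinianRing Λ] (hU : IsWide Λ U) (hV : IsWide Λ V)
    (hVU : V ⊆ U) (h : simOf Λ U ⊆ V) : U ⊆ V := by
  intro M hM
  have : Module.Finite Λ M := hU.1 M hM
  obtain ⟨P, hPV, hmax⟩ := WellFounded.has_min (wellFounded_gt (α := Submodule Λ M))
    {P | ModuleCat.of Λ P ∈ V}
    ⟨⊥, hV.2.2.1 _ (inferInstanceAs (Subsingleton (⊥ : Submodule Λ M)))⟩
  have hQ : ModuleCat.of Λ (M ⧸ P) ∈ U := by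
    have := hU.2.2.2.2.1 (M := ModuleCat.of Λ P) P.subtype (hVU hPV) hM
    exact hU.2.1 ⟨Submodule.quotEquivOfEq _ _ (Submodule.range_subtype P)⟩ this
  by_cases hP : P = ⊤
  · subst hP
    exact hV.2.1 ⟨Submodule.topEquiv⟩ hPV
  · obtain ⟨T, hT0, hT⟩ := hU.exists_submodule_mem_simOf hQ (Submodule.Quotient.nontrivial_iff.2 hP)
    let R : Submodule Λ M := T.comap P.mkQ
    have hPR : P ≤ R := fun x hx => by
      change Submodule.Quotient.mk x ∈ T
      rw [(Submodule.Quotient.mk_eq_zero P).2 hx]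
      exact T.zero_mem
    have hRV : ModuleCat.of Λ R ∈ V := by
      refine hV.2.2.2.2.2 (A := ModuleCat.of Λ P) (B := ModuleCat.of Λ T) (Submodule.inclusion hPR)
        (P.mkQ.restrict fun x hx => hx) (Submodule.inclusion_injective hPR) ?_ ?_ hPV (h hT)
      · rintro ⟨y, hy⟩
        obtain ⟨x, rfl⟩ := P.mkQ_surjective y
        exact ⟨⟨x, hy⟩, rfl⟩
      · rw [Submodule.range_inclusion]
        ext x
        rw [LinearMap.mem_ker, Subtype.ext_iff]
        exact (Submodule.Quotient.mk_eq_zero P).symm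
    refine absurd (lt_of_le_of_ne hPR fun hPR' => hT0 ?_) (hmax R hRV)
    refine (Submodule.eq_bot_iff T).2 fun y hy => ?_
    obtain ⟨x, rfl⟩ := P.mkQ_surjective y
    refine (Submodule.Quotient.mk_eq_zero P).2 ?_
    rw [hPR']
    exact hy

theorem isWide_iUnion {W : ℕ → Set (ModuleCat.{0} Λ)} (hW : ∀ n, IsWide Λ (W n))
    (hmono : Monotone W) : IsWide Λ (⋃ n, W n) := by
  have key {M N : ModuleCat.{0} Λ} (hM : M ∈ ⋃ n, W n) (hN : N ∈ ⋃ n, W n) :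
      ∃ n, M ∈ W n ∧ N ∈ W n := by
    obtain ⟨a, ha⟩ := Set.mem_iUnion.1 hM
    obtain ⟨b, hb⟩ := Set.mem_iUnion.1 hN
    exact ⟨max a b, hmono (le_max_left a b) ha, hmono (le_max_right a b) hb⟩
  refine ⟨fun M hM => ?_, fun M N e hM => ?_, fun M hM => ?_, fun M N f hM hN => ?_,
    fun M N f hM hN => ?_, fun A M B f g hf hg hfg hA hB => ?_⟩
  · obtain ⟨n, hn⟩ := Set.mem_iUnion.1 hM
    exact (hW n).1 M hn
  · obtain ⟨n, hn⟩ := Set.mem_iUnion.1 hM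
    exact Set.mem_iUnion.2 ⟨n, (hW n).2.1 e hn⟩
  · exact Set.mem_iUnion.2 ⟨0, (hW 0).2.2.1 M hM⟩
  · obtain ⟨n, hn, hn'⟩ := key hM hN
    exact Set.mem_iUnion.2 ⟨n, (hW n).2.2.2.1 f hn hn'⟩
  · obtain ⟨n, hn, hn'⟩ := key hM hN
    exact Set.mem_iUnion.2 ⟨n, (hW n).2.2.2.2.1 f hn hn'⟩
  · obtain ⟨n, hn, hn'⟩ := key hA hB
    exact Set.mem_iUnion.2 ⟨n, (hW n).2.2.2.2.2 f g hf hg hfg hn hn'⟩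

theorem exists_infinite_semibrick [IsArtinianRing Λ] {W : ℕ → Set (ModuleCat.{0} Λ)}
    (hW : ∀ n, IsWide Λ (W n)) (hlt : ∀ n, W n ⊂ W (n + 1)) :
    ∃ S, IsSemibrick Λ S ∧ ¬ FiniteUpToIso Λ S := by
  have hmono : Monotone W := monotone_nat_of_le_succ fun n => (hlt n).subset
  have hU := isWide_iUnion hW hmono
  refine ⟨_, hU.isSemibrick_simOf, fun ⟨B, hB, hiso⟩ => ?_⟩
  obtain ⟨n, hn⟩ : ∃ n, B ∩ ⋃ n, W n ⊆ W n := by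
    have hfin := hB.subset (Set.inter_subset_left (t := ⋃ n, W n))
    have := hmono.directed_le.exists_mem_subset_of_finset_subset_biUnion (s := hfin.toFinset)
      (by rw [hfin.coe_toFinset]; exact Set.inter_subset_right)
    rwa [hfin.coe_toFinset] at this
  have hsim : simOf Λ (⋃ n, W n) ⊆ W n := fun M hM => by
    obtain ⟨N, hN, ⟨e⟩⟩ := hiso M hM
    exact (hW n).2.1 ⟨e.symm⟩ (hn ⟨hN, hU.2.1 ⟨e⟩ hM.1⟩)
  exact (hlt n).not_subset ((Set.subset_iUnion W (n + 1)).trans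
    (hU.subset_of_simOf_subset (hW n) (Set.subset_iUnion W n) hsim))

end Simples

/-- There is an infinite semibrick in `mod Λ` iff there is an infinite strictly
increasing chain of wide subcategories of `mod Λ`. -/
theorem exists_infinite_semibrick_iff_strict_wide_chain
    (K Λ : Type) [Field K] [Ring Λ] [Algebra K Λ] [FiniteDimensional K Λ] :
    (∃ S, IsSemibrick Λ S ∧ ¬ FiniteUpToIso Λ S) ↔
      (∃ W : ℕ → Set (ModuleCat.{0} Λ), (∀ n, IsWide Λ (W n)) ∧ ∀ n, W n ⊂ W (n + 1)) := by
  have : IsArtinianRing Λ := IsArtinianRing.of_finite K Λ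
  exact ⟨fun ⟨_, hS, h⟩ => exists_strict_wide_chain hS h,
    fun ⟨_, hW, hlt⟩ => exists_infinite_semibrick hW hlt⟩

end BrickPaper
end

section
/- Let Λ be a finite-dimensional algebra over a field K. The assignments T ↦ MCE(T^⊥) and S ↦ T(S) are mutually inverse bijections between the set of widely generated torsion classes in mod Λ and the set of semibricks in mod Λ; dually, the assignments F ↦ ME(^⊥F) and S ↦ F(S) are mutually inverse bijections between the set of widely generated torsion-free classes in mod Λ and the set of semibricks in mod Λ. -/
open Function DirectSum

namespace BrickPaper

variable (Λ : Type) [Ring Λ]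

section Auxiliary

variable {Λ}

section Factorization

variable {A B C : Type} [AddCommGroup A] [Module Λ A] [AddCommGroup B] [Module Λ B]
  [AddCommGroup C] [Module Λ C]

theorem exists_comp_eq_of_ker_le (g : A →ₗ[Λ] B) (hg : Surjective g) (f : A →ₗ[Λ] C)
    (h : LinearMap.ker g ≤ LinearMap.ker f) : ∃ k : B →ₗ[Λ] C, k ∘ₗ g = f := by
  refine ⟨(LinearMap.ker g).liftQ f h ∘ₗ (g.quotKerEquivOfSurjective hg).symm.toLinearMap, ?_⟩
  ext x
  have : (g.quotKerEquivOfSurjective hg).symm (g x) = (LinearMap.ker g).mkQ x := by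
    rw [LinearEquiv.symm_apply_eq]
    rfl
  simp [this]

theorem exists_comp_eq_of_range_le (i : B →ₗ[Λ] C) (hi : Injective i) (f : A →ₗ[Λ] C)
    (h : LinearMap.range f ≤ LinearMap.range i) : ∃ k : A →ₗ[Λ] B, i ∘ₗ k = f := by
  refine ⟨(LinearEquiv.ofInjective i hi).symm.toLinearMap ∘ₗ
    f.codRestrict (LinearMap.range i) fun x => h ⟨x, rfl⟩, ?_⟩
  ext x
  simp

end Factorization

theorem ExtClosed.mem_of_submodule {C : Set (ModuleCat.{0} Λ)} (hC : ExtClosed Λ C)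
    {M : ModuleCat.{0} Λ} (U : Submodule Λ M) (hU : ModuleCat.of Λ U ∈ C)
    (hQ : ModuleCat.of Λ (M ⧸ U) ∈ C) : M ∈ C :=
  hC (A := ModuleCat.of Λ U) (B := ModuleCat.of Λ (M ⧸ U)) U.subtype U.mkQ
    U.injective_subtype U.mkQ_surjective (by simp) hU hQ

/-! ### The class of finitely generated modules -/

theorem fg_of_exact {A M B : ModuleCat.{0} Λ} (f : A →ₗ[Λ] M) (g : M →ₗ[Λ] B)
    (hg : Surjective g) (h : LinearMap.range f = LinearMap.ker g) (hA : FG Λ A)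
    (hB : FG Λ B) : FG Λ M := by
  refine ⟨Submodule.fg_of_fg_map_of_fg_inf_ker g ?_ ?_⟩
  · rw [Submodule.map_top, LinearMap.range_eq_top.2 hg]
    exact hB.fg_top
  · rw [top_inf_eq, ← h, ← Submodule.map_top]
    exact hA.fg_top.map f

theorem isTorsionClass_fg : IsTorsionClass Λ {M | FG Λ M} := by
  refine ⟨fun M h => h, ?_, ?_, ?_, ?_⟩
  · rintro M N ⟨e⟩ (h : FG Λ M)
    exact Module.Finite.equiv e
  · intro M _
    exact (inferInstance : Module.Finite Λ M)
  · intro M N g hg (h : FG Λ M)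
    exact Module.Finite.of_surjective g hg
  · intro A M B f g _ hg h hA hB
    exact fg_of_exact f g hg h hA hB

theorem isTorsionFreeClass_fg [IsNoetherianRing Λ] : IsTorsionFreeClass Λ {M | FG Λ M} := by
  obtain ⟨h, hi, hz, -, he⟩ := isTorsionClass_fg (Λ := Λ)
  refine ⟨h, hi, hz, ?_, he⟩
  intro M N f hf (h : FG Λ N)
  exact Module.Finite.of_injective f hf

/-! ### Closures -/

theorem subset_torsClosure (X : Set (ModuleCat.{0} Λ)) : X ⊆ torsClosure Λ X :=
  fun _ hM _ hC => hC.2 hM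

theorem torsClosure_subset {X C : Set (ModuleCat.{0} Λ)} (hC : IsTorsionClass Λ C)
    (h : X ⊆ C) : torsClosure Λ X ⊆ C :=
  fun _ hM => hM C ⟨hC, h⟩

theorem isTorsionClass_torsClosure {X : Set (ModuleCat.{0} Λ)} (hX : ∀ M ∈ X, FG Λ M) :
    IsTorsionClass Λ (torsClosure Λ X) := by
  refine ⟨fun M hM => torsClosure_subset isTorsionClass_fg hX hM, ?_, ?_, ?_, ?_⟩
  · exact fun M N e hM C hC => hC.1.2.1 e (hM C hC)
  · exact fun M hM C hC => hC.1.2.2.1 M hM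
  · exact fun M N g hg hM C hC => hC.1.2.2.2.1 g hg (hM C hC)
  · exact fun A M B f g hf hg h hA hB C hC => hC.1.2.2.2.2 f g hf hg h (hA C hC) (hB C hC)

theorem subset_torfClosure (X : Set (ModuleCat.{0} Λ)) : X ⊆ torfClosure Λ X :=
  fun _ hM _ hC => hC.2 hM

theorem torfClosure_subset {X C : Set (ModuleCat.{0} Λ)} (hC : IsTorsionFreeClass Λ C)
    (h : X ⊆ C) : torfClosure Λ X ⊆ C :=
  fun _ hM => hM C ⟨hC, h⟩

theorem isTorsionFreeClass_torfClosure [IsNoetherianRing Λ] {X : Set (ModuleCat.{0} Λ)}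
    (hX : ∀ M ∈ X, FG Λ M) : IsTorsionFreeClass Λ (torfClosure Λ X) := by
  refine ⟨fun M hM => torfClosure_subset isTorsionFreeClass_fg hX hM, ?_, ?_, ?_, ?_⟩
  · exact fun M N e hM C hC => hC.1.2.1 e (hM C hC)
  · exact fun M hM C hC => hC.1.2.2.1 M hM
  · exact fun M N g hg hM C hC => hC.1.2.2.2.1 g hg (hM C hC)
  · exact fun A M B f g hf hg h hA hB C hC => hC.1.2.2.2.2 f g hf hg h (hA C hC) (hB C hC)

/-! ### Perpendicular classes -/

theorem isTorsionClass_lPerp (F : Set (ModuleCat.{0} Λ)) : IsTorsionClass Λ (lPerp Λ F) := by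
  have hquot : QuotClosed Λ (lPerp Λ F) := by
    rintro M N g hg ⟨hM, h⟩
    refine ⟨Module.Finite.of_surjective g hg, fun Y hY f => ?_⟩
    exact (LinearMap.cancel_right hg).1 ((h Y hY _).trans (LinearMap.zero_comp g).symm)
  refine ⟨fun M h => h.1, ?_, ?_, hquot, ?_⟩
  · rintro M N ⟨e⟩ hM
    exact hquot e.toLinearMap e.surjective hM
  · intro M _
    exact ⟨(inferInstance : Module.Finite Λ M), fun Y _ f => Subsingleton.elim _ _⟩
  · rintro A M B f g - hg hfg ⟨hA, hA'⟩ ⟨hB, hB'⟩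
    refine ⟨fg_of_exact f g hg hfg hA hB, fun Y hY p => ?_⟩
    obtain ⟨k, rfl⟩ := exists_comp_eq_of_ker_le g hg p <| by
      rw [← hfg, LinearMap.range_le_ker_iff]
      exact hA' Y hY _
    rw [hB' Y hY k, LinearMap.zero_comp]

theorem isTorsionFreeClass_rPerp [IsNoetherianRing Λ] (T : Set (ModuleCat.{0} Λ)) :
    IsTorsionFreeClass Λ (rPerp Λ T) := by
  have hsub : SubClosed Λ (rPerp Λ T) := by
    rintro M N i hi ⟨hN, h⟩
    refine ⟨Module.Finite.of_injective i hi, fun X hX f => ?_⟩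
    exact (LinearMap.cancel_left hi).1 ((h X hX _).trans (LinearMap.comp_zero i).symm)
  refine ⟨fun M h => h.1, ?_, ?_, hsub, ?_⟩
  · rintro M N ⟨e⟩ hM
    exact hsub e.symm.toLinearMap e.symm.injective hM
  · intro M _
    exact ⟨(inferInstance : Module.Finite Λ M), fun Y _ f => Subsingleton.elim _ _⟩
  · rintro A M B f g hf hg hfg ⟨hA, hA'⟩ ⟨hB, hB'⟩
    refine ⟨fg_of_exact f g hg hfg hA hB, fun X hX p => ?_⟩
    obtain ⟨k, rfl⟩ := exists_comp_eq_of_range_le f hf p <| by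
      rw [hfg, LinearMap.range_le_ker_iff]
      exact hB' X hX _
    rw [hA' X hX k, LinearMap.comp_zero]

theorem rPerp_torsClosure {X : Set (ModuleCat.{0} Λ)} (hX : ∀ M ∈ X, FG Λ M) :
    rPerp Λ (torsClosure Λ X) = rPerp Λ X := by
  refine Set.Subset.antisymm (fun M hM => ⟨hM.1, fun Y hY => hM.2 Y (subset_torsClosure X hY)⟩)
    fun M hM => ⟨hM.1, fun Y hY => ?_⟩
  have : torsClosure Λ X ⊆ lPerp Λ (rPerp Λ X) :=
    torsClosure_subset (isTorsionClass_lPerp _) fun Z hZ => ⟨hX Z hZ, fun N hN => hN.2 Z hZ⟩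
  exact (this hY).2 M hM

theorem lPerp_torfClosure [IsNoetherianRing Λ] {X : Set (ModuleCat.{0} Λ)}
    (hX : ∀ M ∈ X, FG Λ M) : lPerp Λ (torfClosure Λ X) = lPerp Λ X := by
  refine Set.Subset.antisymm (fun M hM => ⟨hM.1, fun Y hY => hM.2 Y (subset_torfClosure X hY)⟩)
    fun M hM => ⟨hM.1, fun Y hY => ?_⟩
  have : torfClosure Λ X ⊆ rPerp Λ (lPerp Λ X) :=
    torfClosure_subset (isTorsionFreeClass_rPerp _) fun Z hZ => ⟨hX Z hZ, fun N hN => hN.2 Z hZ⟩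
  exact (this hY).2 M hM

/-! ### Canonical sequences of torsion pairs -/

theorem exists_torsion_submodule [IsNoetherianRing Λ] {T : Set (ModuleCat.{0} Λ)}
    (hT : IsTorsionClass Λ T) (M : ModuleCat.{0} Λ) (hM : FG Λ M) :
    ∃ U : Submodule Λ M, ModuleCat.of Λ U ∈ T ∧ ModuleCat.of Λ (M ⧸ U) ∈ rPerp Λ T := by
  obtain ⟨U, hU, hmax⟩ := (wellFounded_gt (α := Submodule Λ M)).has_min
    {U | ModuleCat.of Λ U ∈ T} ⟨⊥, hT.2.2.1 _ (inferInstanceAs (Subsingleton (⊥ : Submodule Λ M)))⟩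
  refine ⟨U, hU, (inferInstance : Module.Finite Λ (M ⧸ U)), fun X hX (f : X →ₗ[Λ] M ⧸ U) => ?_⟩
  let V := (LinearMap.range f).comap U.mkQ
  have hUV : U ≤ V := fun x hx => by simp [V, (Submodule.Quotient.mk_eq_zero U).2 hx]
  have hV : ModuleCat.of Λ V ∈ T := by
    refine hT.2.2.2.2 (A := ModuleCat.of Λ U) (B := ModuleCat.of Λ (LinearMap.range f))
      (Submodule.inclusion hUV) (U.mkQ.restrict (p := V) (q := LinearMap.range f) fun x hx => hx)
      (Submodule.inclusion_injective hUV) ?_ ?_ hU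
      (hT.2.2.2.1 (M := X) f.rangeRestrict f.surjective_rangeRestrict hX)
    · rintro ⟨y, hy⟩
      obtain ⟨x, rfl⟩ := U.mkQ_surjective y
      exact ⟨⟨x, hy⟩, rfl⟩
    · ext ⟨x, hx⟩
      simp [Submodule.range_inclusion, Subtype.ext_iff]
  have hVU : V = U := (hUV.eq_or_lt.resolve_right (hmax V hV)).symm
  ext x
  obtain ⟨y, hy⟩ := U.mkQ_surjective (f x)
  have : y ∈ V := ⟨x, hy.symm⟩
  rw [hVU] at this
  rw [← hy]
  simpa using this

theorem exists_torsionFree_quotient [IsArtinianRing Λ] {F : Set (ModuleCat.{0} Λ)}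
    (hF : IsTorsionFreeClass Λ F) (M : ModuleCat.{0} Λ) (hM : FG Λ M) :
    ∃ U : Submodule Λ M, ModuleCat.of Λ U ∈ lPerp Λ F ∧ ModuleCat.of Λ (M ⧸ U) ∈ F := by
  obtain ⟨U, hU, hmin⟩ := (wellFounded_lt (α := Submodule Λ M)).has_min
    {U | ModuleCat.of Λ (M ⧸ U) ∈ F} ⟨⊤, hF.2.2.1 _ (inferInstanceAs (Subsingleton (M ⧸ ⊤)))⟩
  refine ⟨U, ⟨(inferInstance : Module.Finite Λ U), fun Y hY (f : U →ₗ[Λ] Y) => ?_⟩, hU⟩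
  let V := (LinearMap.ker f).map U.subtype
  have hVU : V ≤ U := Submodule.map_subtype_le _ _
  have hcomap : V.comap U.subtype = LinearMap.ker f :=
    Submodule.comap_map_eq_of_injective U.injective_subtype _
  have hV : ModuleCat.of Λ (M ⧸ V) ∈ F := by
    refine hF.2.2.2.2 (A := ModuleCat.of Λ (U ⧸ LinearMap.ker f)) (B := ModuleCat.of Λ (M ⧸ U))
      ((LinearMap.ker f).mapQ V U.subtype hcomap.ge) (Submodule.factor hVU) ?_
      (Submodule.factor_surjective hVU) ?_
      (hF.2.2.2.1 (N := Y) ((LinearMap.ker f).liftQ f le_rfl) ?_ hY) hU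
    · rw [← LinearMap.ker_eq_bot, Submodule.ker_mapQ, hcomap, Submodule.mkQ_map_self]
    · rw [Submodule.range_mapQ, Submodule.range_subtype, Submodule.factor, Submodule.ker_mapQ,
        Submodule.comap_id]
    · rw [← LinearMap.ker_eq_bot, Submodule.ker_liftQ, Submodule.mkQ_map_self]
  have hUV : U ≤ V := (hVU.eq_or_lt.resolve_right (hmin V hV)).ge
  ext x
  have : x ∈ V.comap U.subtype := hUV x.2
  rw [hcomap] at this
  exact this

/-! ### Wide subcategories attached to torsion and torsion-free classes -/

theorem isWide_alphaOf {T : Set (ModuleCat.{0} Λ)} (hT : IsTorsionClass Λ T) :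
    IsWide Λ (alphaOf Λ T) := by
  obtain ⟨hfg, hiso, hzero, hquot, hext⟩ := hT
  refine ⟨fun M hM => hfg M hM.1, ?_, ?_, ?_, ?_, ?_⟩
  · rintro M N ⟨e⟩ ⟨hM, h⟩
    refine ⟨hiso ⟨e⟩ hM, fun Y g hY => ?_⟩
    have := h Y (e.symm.toLinearMap ∘ₗ g) hY
    rwa [LinearEquiv.ker_comp] at this
  · intro M hM
    refine ⟨hzero M hM, fun Y g hY => ?_⟩
    have : LinearMap.ker g = ⊤ := by
      rw [Subsingleton.elim g 0, LinearMap.ker_zero]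
    rw [this]
    exact hiso ⟨Submodule.topEquiv.symm⟩ hY
  · rintro M N f ⟨hM, h⟩ ⟨hN, h'⟩
    refine ⟨h' M f hM, fun Y (g : Y →ₗ[Λ] LinearMap.ker f) hY => ?_⟩
    have := h Y ((LinearMap.ker f).subtype ∘ₗ g) hY
    rwa [LinearMap.ker_comp_of_ker_eq_bot _ (Submodule.ker_subtype _)] at this
  · rintro M N f ⟨hM, h⟩ ⟨hN, h'⟩
    refine ⟨hquot (M := N) (LinearMap.range f).mkQ (Submodule.mkQ_surjective _) hN,
      fun Y (g : Y →ₗ[Λ] N ⧸ LinearMap.range f) hY => ?_⟩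
    let q := (LinearMap.range f).mkQ
    let P : Submodule Λ (Y × N) := LinearMap.eqLocus (g ∘ₗ LinearMap.fst Λ Y N)
      (q ∘ₗ LinearMap.snd Λ Y N)
    have hP : ModuleCat.of Λ P ∈ T := by
      refine hext (A := ModuleCat.of Λ (LinearMap.range f)) (B := Y)
        ((LinearMap.inr Λ Y N ∘ₗ (LinearMap.range f).subtype).codRestrict P ?_)
        (LinearMap.fst Λ Y N ∘ₗ P.subtype) ?_ ?_ ?_
        (hquot (M := M) f.rangeRestrict f.surjective_rangeRestrict hM) hY
      · rintro ⟨x, hx⟩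
        have : q x = 0 := (Submodule.Quotient.mk_eq_zero _).2 hx
        exact (map_zero g).trans this.symm
      · intro x y hxy
        exact Subtype.ext (congrArg (fun p : P => p.1.2) hxy)
      · intro y
        obtain ⟨x, hx⟩ := Submodule.mkQ_surjective _ (g y)
        exact ⟨⟨(y, x), hx.symm⟩, rfl⟩
      · ext ⟨⟨y, x⟩, hyx⟩
        constructor
        · rintro ⟨⟨z, hz⟩, h⟩
          have := congrArg (fun p : P => p.1.1) h
          exact this.symm
        · intro h
          obtain rfl : y = 0 := h
          have hyx : g 0 = q x := hyx
          rw [map_zero] at hyx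
          have hx : x ∈ LinearMap.range f := (Submodule.Quotient.mk_eq_zero _).1 hyx.symm
          exact ⟨⟨x, hx⟩, rfl⟩
    refine hiso ⟨?_⟩ (h' (ModuleCat.of Λ P) (LinearMap.snd Λ Y N ∘ₗ P.subtype) hP)
    refine LinearEquiv.ofBijective (((LinearMap.fst Λ Y N ∘ₗ P.subtype).restrict
      (p := LinearMap.ker (LinearMap.snd Λ Y N ∘ₗ P.subtype)) (q := LinearMap.ker g)) ?_) ⟨?_, ?_⟩
    · rintro ⟨⟨y, x⟩, hyx⟩ h
      obtain rfl : x = 0 := h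
      simpa [P, LinearMap.mem_eqLocus] using hyx
    · rintro ⟨⟨⟨y, x⟩, hyx⟩, h⟩ ⟨⟨⟨y', x'⟩, hyx'⟩, h'⟩ heq
      obtain rfl : x = 0 := h
      obtain rfl : x' = 0 := h'
      obtain rfl : y = y' := congrArg Subtype.val heq
      rfl
    · rintro ⟨y, hy⟩
      have hy' : g y = 0 := hy
      exact ⟨⟨⟨(y, 0), by simp [P, LinearMap.mem_eqLocus, hy']⟩, rfl⟩, rfl⟩
  · rintro A M B f g hf hg hfg ⟨hA, h⟩ ⟨hB, h'⟩
    refine ⟨hext f g hf hg hfg hA hB, fun Y p hY => ?_⟩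
    have hK := h' Y (g ∘ₗ p) hY
    obtain ⟨k, hk⟩ := exists_comp_eq_of_range_le f hf
      (p ∘ₗ (LinearMap.ker (g ∘ₗ p)).subtype) <| by
        rw [hfg, LinearMap.range_le_ker_iff, ← LinearMap.comp_assoc]
        exact LinearMap.comp_ker_subtype _
    refine hiso ⟨?_⟩ (h (ModuleCat.of Λ _) k hK)
    have hker : LinearMap.ker k = (LinearMap.ker p).comap (LinearMap.ker (g ∘ₗ p)).subtype := by
      rw [← LinearMap.ker_comp, ← hk, LinearMap.ker_comp_of_ker_eq_bot _ (LinearMap.ker_eq_bot.2 hf)]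
    rw [hker]
    exact Submodule.comapSubtypeEquivOfLe (LinearMap.ker_le_ker_comp p g)

/-- The subcategory `{X ∈ F : for all g : X → Y with Y ∈ F, coker g ∈ F}`. -/
def betaOf (F : Set (ModuleCat.{0} Λ)) : Set (ModuleCat.{0} Λ) :=
  {X | X ∈ F ∧ ∀ (Y : ModuleCat.{0} Λ) (g : X →ₗ[Λ] Y), Y ∈ F →
    ModuleCat.of Λ (Y ⧸ LinearMap.range g) ∈ F}

theorem isWide_betaOf {F : Set (ModuleCat.{0} Λ)} (hF : IsTorsionFreeClass Λ F) :
    IsWide Λ (betaOf F) := by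
  obtain ⟨hfg, hiso, hzero, hsub, hext⟩ := hF
  refine ⟨fun M hM => hfg M hM.1, ?_, ?_, ?_, ?_, ?_⟩
  · rintro M N ⟨e⟩ ⟨hM, h⟩
    refine ⟨hiso ⟨e⟩ hM, fun Y g hY => ?_⟩
    have := h Y (g ∘ₗ e.toLinearMap) hY
    rwa [LinearMap.range_comp_of_range_eq_top _ (LinearEquiv.range e)] at this
  · intro M hM
    refine ⟨hzero M hM, fun Y g hY => ?_⟩
    have : LinearMap.range g = ⊥ := by
      rw [Subsingleton.elim g 0, LinearMap.range_zero]
    rw [this]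
    exact hiso ⟨(Submodule.quotEquivOfEqBot ⊥ rfl).symm⟩ hY
  · rintro M N f ⟨hM, h⟩ ⟨hN, h'⟩
    refine ⟨hsub (N := M) (LinearMap.ker f).subtype (Submodule.injective_subtype _) hM,
      fun Y (g : LinearMap.ker f →ₗ[Λ] Y) hY => ?_⟩
    let i := (LinearMap.ker f).subtype
    let R : Submodule Λ (Y × M) := LinearMap.range (g.prod (-i))
    let p : M →ₗ[Λ] (Y × M) ⧸ R := R.mkQ ∘ₗ LinearMap.inr Λ Y M
    have hR : R ≤ LinearMap.ker (f ∘ₗ LinearMap.snd Λ Y M) := by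
      rintro _ ⟨x, rfl⟩
      simp [i]
    have hP : ModuleCat.of Λ ((Y × M) ⧸ R) ∈ F := by
      refine hext (A := Y) (B := ModuleCat.of Λ (LinearMap.range f))
        (R.mkQ ∘ₗ LinearMap.inl Λ Y M)
        ((R.liftQ (f ∘ₗ LinearMap.snd Λ Y M) hR).codRestrict (LinearMap.range f) ?_) ?_ ?_ ?_
        hY (hsub (N := N) (LinearMap.range f).subtype (Submodule.injective_subtype _) hN)
      · intro z
        obtain ⟨⟨y, m⟩, rfl⟩ := R.mkQ_surjective z
        exact ⟨m, rfl⟩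
      · rw [← LinearMap.ker_eq_bot, LinearMap.ker_eq_bot']
        intro y hy
        have : (y, (0 : M)) ∈ R := by simpa using hy
        obtain ⟨x, hx⟩ := this
        obtain ⟨h1, h2⟩ := Prod.ext_iff.1 hx
        have hx0 : x = 0 := by
          ext
          simpa [i] using h2
        simpa [hx0] using h1.symm
      · rintro ⟨_, m, rfl⟩
        exact ⟨R.mkQ (0, m), rfl⟩
      · ext z
        obtain ⟨⟨y, m⟩, rfl⟩ := R.mkQ_surjective z
        constructor
        · rintro ⟨y', hy'⟩
          rw [← hy']
          ext
          exact map_zero f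
        · intro h
          have hm : f m = 0 := congrArg Subtype.val h
          refine ⟨y + g ⟨m, hm⟩, ?_⟩
          refine (Submodule.Quotient.eq R).2 ⟨⟨m, hm⟩, ?_⟩
          ext <;> simp [i]
    refine hiso ⟨?_⟩ (h (ModuleCat.of Λ ((Y × M) ⧸ R)) p hP)
    let a : Y × M →ₗ[Λ] Y ⧸ LinearMap.range g := (LinearMap.range g).mkQ ∘ₗ LinearMap.fst Λ Y M
    have ha : R ≤ LinearMap.ker a := by
      rintro _ ⟨x, rfl⟩
      simp [a]
    have hb : LinearMap.range p ≤ LinearMap.ker (R.liftQ a ha) := by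
      rintro _ ⟨x, rfl⟩
      simp [a, p]
    refine LinearEquiv.ofBijective ((LinearMap.range p).liftQ (R.liftQ a ha) hb) ⟨?_, ?_⟩
    · rw [← LinearMap.ker_eq_bot, LinearMap.ker_eq_bot']
      intro z hz
      obtain ⟨z, rfl⟩ := Submodule.mkQ_surjective _ z
      obtain ⟨⟨y, m⟩, rfl⟩ := R.mkQ_surjective z
      have hy : y ∈ LinearMap.range g := by simpa [a] using hz
      obtain ⟨x, rfl⟩ := hy
      refine (Submodule.Quotient.mk_eq_zero _).2 ⟨m + i x, ?_⟩
      refine (Submodule.Quotient.eq R).2 ⟨-x, ?_⟩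
      ext <;> simp [i]
    · intro z
      obtain ⟨y, rfl⟩ := Submodule.mkQ_surjective _ z
      exact ⟨Submodule.mkQ _ (R.mkQ (y, 0)), rfl⟩
  · rintro M N f ⟨hM, h⟩ ⟨hN, h'⟩
    refine ⟨h N f hN, fun Y (g : N ⧸ LinearMap.range f →ₗ[Λ] Y) hY => ?_⟩
    have := h' Y (g ∘ₗ (LinearMap.range f).mkQ) hY
    rwa [LinearMap.range_comp_of_range_eq_top _ (Submodule.range_mkQ _)] at this
  · rintro A M B f g hf hg hfg ⟨hA, h⟩ ⟨hB, h'⟩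
    refine ⟨hext f g hf hg hfg hA hB, fun Y p hY => ?_⟩
    have hK := h Y (p ∘ₗ f) hY
    obtain ⟨k, hk⟩ := exists_comp_eq_of_ker_le g hg
      ((LinearMap.range (p ∘ₗ f)).mkQ ∘ₗ p) <| by
        rw [← hfg, LinearMap.range_le_ker_iff, LinearMap.comp_assoc]
        exact LinearMap.range_mkQ_comp _
    refine hiso ⟨?_⟩ (h' (ModuleCat.of Λ _) k hK)
    have hrange : LinearMap.range k = (LinearMap.range p).map (LinearMap.range (p ∘ₗ f)).mkQ := by
      rw [← LinearMap.range_comp, ← hk,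
        LinearMap.range_comp_of_range_eq_top _ (LinearMap.range_eq_top.2 hg)]
    rw [hrange]
    exact Submodule.quotientQuotientEquivQuotient _ _ (LinearMap.range_comp_le_range f p)

/-! ### Simple objects of wide subcategories -/

theorem IsSemibrick.bijective {S : Set (ModuleCat.{0} Λ)} (hS : IsSemibrick Λ S)
    {M N : ModuleCat.{0} Λ} (hM : M ∈ S) (hN : N ∈ S) (f : M →ₗ[Λ] N) (hf : f ≠ 0) :
    Bijective f := by
  obtain ⟨hbrick, -, horth⟩ := hS
  by_cases h : IsEmpty (M ≃ₗ[Λ] N)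
  · exact absurd (horth M hM N hN h f) hf
  · obtain ⟨e⟩ := not_isEmpty_iff.1 h
    have : Bijective (e.symm.toLinearMap ∘ₗ f) :=
      (hbrick M hM).2.2 _ fun h0 => hf <| by
        ext x
        simpa using LinearMap.congr_fun h0 x
    exact (e.symm.bijective.of_comp_iff' f).1 this

theorem IsWide.simOf_bijective {W : Set (ModuleCat.{0} Λ)} (hW : IsWide Λ W)
    {M N : ModuleCat.{0} Λ} (hM : M ∈ simOf Λ W) (hN : N ∈ simOf Λ W) (f : M →ₗ[Λ] N)
    (hf : f ≠ 0) : Bijective f := by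
  obtain ⟨-, hiso, -, hker, hcoker, -⟩ := hW
  constructor
  · have := hM.2.2 (ModuleCat.of Λ (LinearMap.ker f)) (LinearMap.ker f).subtype
      (hker f hM.1 hN.1) (Submodule.injective_subtype _)
    rw [Submodule.range_subtype, LinearMap.ker_eq_top] at this
    exact LinearMap.ker_eq_bot.1 (this.resolve_right hf)
  · have hrange : ModuleCat.of Λ (LinearMap.range f) ∈ W := by
      have := hker (N := ModuleCat.of Λ (N ⧸ LinearMap.range f)) (LinearMap.range f).mkQ hN.1
        (hcoker f hM.1 hN.1)
      rwa [Submodule.ker_mkQ] at this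
    have := hN.2.2 (ModuleCat.of Λ (LinearMap.range f)) (LinearMap.range f).subtype
      hrange (Submodule.injective_subtype _)
    rw [Submodule.range_subtype, LinearMap.range_eq_bot] at this
    exact LinearMap.range_eq_top.1 (this.resolve_left hf)

theorem IsWide.isSemibrick_simOf_s2 {W : Set (ModuleCat.{0} Λ)} (hW : IsWide Λ W) :
    IsSemibrick Λ (simOf Λ W) := by
  refine ⟨fun M hM => ⟨hW.1 M hM.1, hM.2.1, hW.simOf_bijective hM hM⟩, ?_, ?_⟩
  · rintro M N ⟨e⟩ ⟨hM, hnt, h⟩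
    refine ⟨hW.2.1 ⟨e⟩ hM, e.symm.toEquiv.nontrivial, fun X f hX hf => ?_⟩
    have := h X (e.symm.toLinearMap ∘ₗ f) hX (e.symm.injective.comp hf)
    rw [LinearMap.range_comp] at this
    exact this.imp Submodule.map_eq_bot_iff.1 Submodule.map_eq_top_iff.1
  · intro M hM N hN hempty f
    by_contra hf
    exact hempty.elim (LinearEquiv.ofBijective f (hW.simOf_bijective hM hN f hf))

theorem IsWide.subset_of_simOf_subset_s2 [IsArtinianRing Λ] {W C : Set (ModuleCat.{0} Λ)}
    (hW : IsWide Λ W) (hzero : HasZeroObj Λ C) (hext : ExtClosed Λ C) (h : simOf Λ W ⊆ C) :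
    W ⊆ C := by
  intro M hM
  induction hn : Module.length Λ M using WellFoundedLT.induction generalizing M with
  | ind n ih =>
    subst hn
    have := hW.1 M hM
    rcases subsingleton_or_nontrivial M with hs | hnt
    · exact hzero M hs
    by_cases hsim : M ∈ simOf Λ W
    · exact h hsim
    · have : ∃ (X : ModuleCat.{0} Λ) (f : X →ₗ[Λ] M), X ∈ W ∧ Injective f ∧
          LinearMap.range f ≠ ⊥ ∧ LinearMap.range f ≠ ⊤ := by
        by_contra! hcon
        exact hsim ⟨hM, hnt, fun X f hX hf => or_iff_not_imp_left.2 (hcon X f hX hf)⟩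
      obtain ⟨X, f, hX, hf, hbot, htop⟩ := this
      refine hext (B := ModuleCat.of Λ (M ⧸ LinearMap.range f)) f (LinearMap.range f).mkQ hf
        (Submodule.mkQ_surjective _) (by simp) (ih _ ?_ hX rfl)
        (ih _ ?_ (hW.2.2.2.2.1 f hX hM) rfl)
      · rw [(LinearEquiv.ofInjective f hf).length_eq]
        exact Submodule.length_lt htop
      · exact Submodule.length_quotient_lt _ hbot

/-! ### Minimal extending and co-extending modules -/

theorem IsMinCoext.bijective {F : Set (ModuleCat.{0} Λ)} {M N : ModuleCat.{0} Λ}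
    (hM : IsMinCoext Λ F M) (hN : IsMinCoext Λ F N) (f : M →ₗ[Λ] N) (hf : f ≠ 0) :
    Bijective f := by
  obtain ⟨-, hnt, hsub, -, hperp⟩ := hM
  obtain ⟨-, -, hsub', hext', -⟩ := hN
  have hsurj : Surjective f := by
    by_contra h
    refine hf ?_
    rw [← LinearMap.range_eq_top] at h
    have := hperp _ (hsub' _ h) f.rangeRestrict
    ext x
    exact congrArg Subtype.val (LinearMap.congr_fun this x)
  have hker : ModuleCat.of Λ (LinearMap.ker f) ∈ F :=
    hsub _ fun h => hf (LinearMap.ker_eq_top.1 h)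
  refine ⟨?_, hsurj⟩
  by_cases hs : ∃ s : N →ₗ[Λ] M, f ∘ₗ s = LinearMap.id
  · obtain ⟨s, hs⟩ := hs
    have hzero := hperp _ hker ((LinearMap.id - s ∘ₗ f).codRestrict (LinearMap.ker f) fun x => by
      have := LinearMap.congr_fun hs (f x)
      simp only [LinearMap.comp_apply, LinearMap.id_apply] at this
      simp [this])
    refine Function.LeftInverse.injective (g := s) fun x => ?_
    have := congrArg Subtype.val (LinearMap.congr_fun hzero x)
    exact (sub_eq_zero.1 this).symm
  · have hMF : M ∈ F := hext' M (ModuleCat.of Λ (LinearMap.ker f)) (LinearMap.ker f).subtype f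
      (Submodule.injective_subtype _) hsurj (by simp) hker hs
    obtain ⟨x, hx⟩ := exists_ne (0 : M)
    exact absurd (LinearMap.congr_fun (hperp M hMF LinearMap.id) x) hx

theorem IsMinExt.bijective {T : Set (ModuleCat.{0} Λ)} {M N : ModuleCat.{0} Λ}
    (hM : IsMinExt Λ T M) (hN : IsMinExt Λ T N) (f : M →ₗ[Λ] N) (hf : f ≠ 0) :
    Bijective f := by
  obtain ⟨-, -, hquot, hext, -⟩ := hM
  obtain ⟨-, hnt, hquot', -, hperp'⟩ := hN
  have hinj : Injective f := by
    by_contra h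
    refine hf ?_
    rw [← LinearMap.ker_eq_bot] at h
    have := hperp' _ (hquot _ h) ((LinearMap.ker f).liftQ f le_rfl)
    ext x
    exact LinearMap.congr_fun this (Submodule.Quotient.mk x)
  have hcoker : ModuleCat.of Λ (N ⧸ LinearMap.range f) ∈ T :=
    hquot' _ fun h => hf (LinearMap.range_eq_bot.1 h)
  refine ⟨hinj, ?_⟩
  by_cases hr : ∃ r : N →ₗ[Λ] M, r ∘ₗ f = LinearMap.id
  · obtain ⟨r, hr⟩ := hr
    have hzero := hperp' _ hcoker ((LinearMap.range f).liftQ (LinearMap.id - f ∘ₗ r) <| by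
      rintro _ ⟨x, rfl⟩
      have := LinearMap.congr_fun hr x
      simp only [LinearMap.comp_apply, LinearMap.id_apply] at this
      simp [this])
    refine Function.RightInverse.surjective (g := r) fun x => ?_
    have := LinearMap.congr_fun hzero (Submodule.Quotient.mk x)
    exact (sub_eq_zero.1 this).symm
  · have hNT : N ∈ T := hext N (ModuleCat.of Λ (N ⧸ LinearMap.range f)) f (LinearMap.range f).mkQ
      hinj (Submodule.mkQ_surjective _) (by simp) hcoker hr
    obtain ⟨x, hx⟩ := exists_ne (0 : N)
    exact absurd (LinearMap.congr_fun (hperp' N hNT LinearMap.id) x) hx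

/-! ### Semibricks as minimal co-extending modules -/

theorem IsSemibrick.isMinCoext [IsNoetherianRing Λ] {S : Set (ModuleCat.{0} Λ)}
    (hS : IsSemibrick Λ S) {M : ModuleCat.{0} Λ} (hM : M ∈ S) :
    IsMinCoext Λ (rPerp Λ S) M := by
  obtain ⟨hMfg, hnt, -⟩ := hS.1 M hM
  refine ⟨hMfg, hnt, fun U hU => ⟨(inferInstance : Module.Finite Λ U),
    fun B hB (f : B →ₗ[Λ] U) => ?_⟩, ?_, fun Y hY => hY.2 M hM⟩
  · by_contra hf
    have := hS.bijective hB hM (U.subtype ∘ₗ f) fun h => hf <| by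
      rwa [← LinearMap.cancel_left U.injective_subtype, LinearMap.comp_zero]
    refine hU (Submodule.eq_top_iff'.2 fun x => ?_)
    obtain ⟨b, rfl⟩ := this.2 x
    exact (f b).2
  · intro X F' f g hf hg hfg hF' hsplit
    refine ⟨fg_of_exact f g hg hfg hF'.1 hMfg, fun B hB p => ?_⟩
    by_cases hgp : g ∘ₗ p = 0
    · obtain ⟨k, rfl⟩ := exists_comp_eq_of_range_le f hf p <| by
        rwa [hfg, LinearMap.range_le_ker_iff]
      rw [hF'.2 B hB k, LinearMap.comp_zero]
    · let e := LinearEquiv.ofBijective _ (hS.bijective hB hM (g ∘ₗ p) hgp)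
      refine absurd ⟨p ∘ₗ e.symm.toLinearMap, ?_⟩ hsplit
      ext x
      exact e.apply_symm_apply x

theorem IsSemibrick.isMinExt [IsNoetherianRing Λ] {S : Set (ModuleCat.{0} Λ)}
    (hS : IsSemibrick Λ S) {M : ModuleCat.{0} Λ} (hM : M ∈ S) :
    IsMinExt Λ (lPerp Λ S) M := by
  obtain ⟨hMfg, hnt, -⟩ := hS.1 M hM
  refine ⟨hMfg, hnt, fun U hU => ⟨(inferInstance : Module.Finite Λ (M ⧸ U)),
    fun B hB (f : M ⧸ U →ₗ[Λ] B) => ?_⟩, ?_, fun Y hY => hY.2 M hM⟩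
  · by_contra hf
    have := hS.bijective hM hB (f ∘ₗ U.mkQ) fun h => hf <| by
      rwa [← LinearMap.cancel_right U.mkQ_surjective, LinearMap.zero_comp]
    refine hU (eq_bot_iff.2 fun x hx => this.1 ?_)
    simp [(Submodule.Quotient.mk_eq_zero U).2 hx]
  · intro X T' f g hf hg hfg hT' hsplit
    refine ⟨fg_of_exact f g hg hfg hMfg hT'.1, fun B hB p => ?_⟩
    by_cases hpf : p ∘ₗ f = 0
    · obtain ⟨k, rfl⟩ := exists_comp_eq_of_ker_le g hg p <| by
        rwa [← hfg, LinearMap.range_le_ker_iff]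
      rw [hT'.2 B hB k, LinearMap.zero_comp]
    · let e := LinearEquiv.ofBijective _ (hS.bijective hM hB (p ∘ₗ f) hpf)
      refine absurd ⟨e.symm.toLinearMap ∘ₗ p, ?_⟩ hsplit
      ext x
      exact e.symm_apply_apply x

theorem IsSemibrick.MCE_rPerp [IsNoetherianRing Λ] {S : Set (ModuleCat.{0} Λ)}
    (hS : IsSemibrick Λ S) : MCE Λ (rPerp Λ (torsClosure Λ S)) = S := by
  rw [rPerp_torsClosure fun M hM => (hS.1 M hM).1]
  refine Set.Subset.antisymm (fun M hM => ?_) fun M hM => hS.isMinCoext hM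
  have : M ∉ rPerp Λ S := fun h => by
    have := hM.2.1
    obtain ⟨x, hx⟩ := exists_ne (0 : M)
    exact hx (LinearMap.congr_fun (hM.2.2.2.2 M h LinearMap.id) x)
  have : ∃ B ∈ S, ∃ f : B →ₗ[Λ] M, f ≠ 0 := by
    by_contra! h
    exact this ⟨hM.1, h⟩
  obtain ⟨B, hB, f, hf⟩ := this
  exact hS.2.1 ⟨LinearEquiv.ofBijective f ((hS.isMinCoext hB).bijective hM f hf)⟩ hB

theorem IsSemibrick.ME_lPerp [IsNoetherianRing Λ] {S : Set (ModuleCat.{0} Λ)}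
    (hS : IsSemibrick Λ S) : ME Λ (lPerp Λ (torfClosure Λ S)) = S := by
  rw [lPerp_torfClosure fun M hM => (hS.1 M hM).1]
  refine Set.Subset.antisymm (fun M hM => ?_) fun M hM => hS.isMinExt hM
  have : M ∉ lPerp Λ S := fun h => by
    have := hM.2.1
    obtain ⟨x, hx⟩ := exists_ne (0 : M)
    exact hx (LinearMap.congr_fun (hM.2.2.2.2 M h LinearMap.id) x)
  have : ∃ B ∈ S, ∃ f : M →ₗ[Λ] B, f ≠ 0 := by
    by_contra! h
    exact this ⟨hM.1, h⟩
  obtain ⟨B, hB, f, hf⟩ := this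
  exact hS.2.1 ⟨(LinearEquiv.ofBijective f (IsMinExt.bijective hM (hS.isMinExt hB) f hf)).symm⟩ hB

theorem IsSemibrick.subset_alphaOf [IsNoetherianRing Λ] {S : Set (ModuleCat.{0} Λ)}
    (hS : IsSemibrick Λ S) : S ⊆ alphaOf Λ (torsClosure Λ S) := by
  have hfg : ∀ M ∈ S, FG Λ M := fun M hM => (hS.1 M hM).1
  have hT := isTorsionClass_torsClosure hfg
  intro B hB
  have hBc : IsMinCoext Λ (rPerp Λ (torsClosure Λ S)) B := by
    rw [rPerp_torsClosure hfg]
    exact hS.isMinCoext hB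
  refine ⟨subset_torsClosure S hB, fun Y g hY => ?_⟩
  have hYfg : FG Λ Y := hT.1 Y hY
  by_cases hg0 : g = 0
  · subst hg0
    rw [LinearMap.ker_zero]
    exact hT.2.1 ⟨Submodule.topEquiv.symm⟩ hY
  have hg : Surjective g := by
    by_contra h
    refine hg0 ?_
    rw [← LinearMap.range_eq_top] at h
    have := (hBc.2.2.1 _ h).2 Y hY g.rangeRestrict
    ext x
    exact congrArg Subtype.val (LinearMap.congr_fun this x)
  obtain ⟨U, hU, hQ⟩ := exists_torsion_submodule hT (ModuleCat.of Λ (LinearMap.ker g))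
    (inferInstanceAs (Module.Finite Λ (LinearMap.ker g)))
  let i := (LinearMap.ker g).subtype
  let V : Submodule Λ Y := Submodule.map i U
  have hcomap : V.comap i = U := Submodule.comap_map_eq_of_injective (Submodule.injective_subtype _) U
  have hVg : V ≤ LinearMap.ker g := Submodule.map_subtype_le _ _
  let j : (LinearMap.ker g ⧸ U) →ₗ[Λ] Y ⧸ V := U.mapQ V i hcomap.ge
  let q : Y ⧸ V →ₗ[Λ] B := V.liftQ g hVg
  have hj : Injective j := by
    rw [← LinearMap.ker_eq_bot, Submodule.ker_mapQ, hcomap, Submodule.mkQ_map_self]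
  have hq : Surjective q := fun b => by
    obtain ⟨y, rfl⟩ := hg b
    exact ⟨V.mkQ y, rfl⟩
  have hjq : LinearMap.range j = LinearMap.ker q := by
    rw [Submodule.range_mapQ, Submodule.range_subtype, Submodule.ker_liftQ]
  by_cases hs : ∃ s : B →ₗ[Λ] Y ⧸ V, q ∘ₗ s = LinearMap.id
  · obtain ⟨s, hs⟩ := hs
    obtain ⟨k, hk⟩ := exists_comp_eq_of_range_le j hj (V.mkQ - s ∘ₗ g) <| by
      rw [hjq]
      rintro _ ⟨y, rfl⟩
      have := LinearMap.congr_fun hs (g y)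
      simp only [LinearMap.comp_apply, LinearMap.id_apply] at this
      simp [this, q]
    rw [hQ.2 Y hY k, LinearMap.comp_zero] at hk
    have hUtop : U = ⊤ := by
      refine Submodule.eq_top_iff'.2 fun x => ?_
      rw [← hcomap]
      have := LinearMap.congr_fun hk x.1
      have hx : g x.1 = 0 := x.2
      simpa [hx, i] using this.symm
    rw [hUtop] at hU
    exact hT.2.1 ⟨Submodule.topEquiv⟩ hU
  · have hYV := hBc.2.2.2.1 (ModuleCat.of Λ (Y ⧸ V)) (ModuleCat.of Λ (LinearMap.ker g ⧸ U)) j q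
      hj hq hjq hQ hs
    refine absurd ?_ hg0
    have := hYV.2 Y hY V.mkQ
    rw [← LinearMap.ker_eq_top, Submodule.ker_mkQ] at this
    exact LinearMap.ker_eq_top.1 (top_le_iff.1 (this ▸ hVg))

theorem IsSemibrick.subset_betaOf [IsArtinianRing Λ] {S : Set (ModuleCat.{0} Λ)}
    (hS : IsSemibrick Λ S) : S ⊆ betaOf (torfClosure Λ S) := by
  have hfg : ∀ M ∈ S, FG Λ M := fun M hM => (hS.1 M hM).1
  have hF := isTorsionFreeClass_torfClosure hfg
  intro B hB
  have hBe : IsMinExt Λ (lPerp Λ (torfClosure Λ S)) B := by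
    rw [lPerp_torfClosure hfg]
    exact hS.isMinExt hB
  refine ⟨subset_torfClosure S hB, fun Y g hY => ?_⟩
  have hYfg : FG Λ Y := hF.1 Y hY
  by_cases hg0 : g = 0
  · subst hg0
    rw [LinearMap.range_zero]
    exact hF.2.1 ⟨(Submodule.quotEquivOfEqBot ⊥ rfl).symm⟩ hY
  have hg : Injective g := by
    by_contra h
    refine hg0 ?_
    rw [← LinearMap.ker_eq_bot] at h
    have := (hBe.2.2.1 _ h).2 Y hY ((LinearMap.ker g).liftQ g le_rfl)
    ext x
    exact LinearMap.congr_fun this (Submodule.Quotient.mk x)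
  obtain ⟨U, hU, hQ⟩ := exists_torsionFree_quotient hF (ModuleCat.of Λ (Y ⧸ LinearMap.range g))
    (inferInstanceAs (Module.Finite Λ (Y ⧸ LinearMap.range g)))
  let p := (LinearMap.range g).mkQ
  let V : Submodule Λ Y := Submodule.comap p U
  have hpg (x : B) : p (g x) = 0 := (Submodule.Quotient.mk_eq_zero _).2 ⟨x, rfl⟩
  let j : B →ₗ[Λ] V := g.codRestrict V fun x => by
    simp only [V, Submodule.mem_comap, hpg, U.zero_mem]
  let q : V →ₗ[Λ] U := p.restrict fun x hx => hx
  have hj : Injective j := fun x y h => hg (congrArg Subtype.val h)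
  have hq : Surjective q := by
    rintro ⟨u, hu⟩
    obtain ⟨y, rfl⟩ := Submodule.mkQ_surjective _ u
    exact ⟨⟨y, hu⟩, rfl⟩
  have hjq : LinearMap.range j = LinearMap.ker q := by
    ext ⟨y, hy⟩
    constructor
    · rintro ⟨x, hx⟩
      rw [← hx]
      exact Subtype.ext (hpg x)
    · intro h
      obtain ⟨x, rfl⟩ := (Submodule.Quotient.mk_eq_zero _).1 (congrArg Subtype.val h)
      exact ⟨x, rfl⟩
  by_cases hr : ∃ r : V →ₗ[Λ] B, r ∘ₗ j = LinearMap.id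
  · obtain ⟨r, hr⟩ := hr
    obtain ⟨k, hk⟩ := exists_comp_eq_of_ker_le q hq (V.subtype - g ∘ₗ r) <| by
      rw [← hjq]
      rintro _ ⟨x, rfl⟩
      have := LinearMap.congr_fun hr x
      simp only [LinearMap.comp_apply, LinearMap.id_apply] at this
      simp [this, j]
    rw [hU.2 Y hY k, LinearMap.zero_comp] at hk
    have hUbot : U = ⊥ := by
      refine eq_bot_iff.2 fun u hu => ?_
      obtain ⟨y, rfl⟩ := Submodule.mkQ_surjective _ u
      have := LinearMap.congr_fun hk ⟨y, hu⟩
      exact (Submodule.Quotient.mk_eq_zero _).2 ⟨r ⟨y, hu⟩, (sub_eq_zero.1 this.symm).symm⟩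
    rw [hUbot] at hQ
    exact hF.2.1 ⟨Submodule.quotEquivOfEqBot ⊥ rfl⟩ hQ
  · have hV := hBe.2.2.2.1 (ModuleCat.of Λ V) (ModuleCat.of Λ U) j q hj hq hjq hU hr
    refine absurd ?_ hg0
    have := hV.2 Y hY V.subtype
    ext x
    exact LinearMap.congr_fun this (j x)

/-! ### Widely generated classes and semibricks -/

theorem IsSemibrick.isWidelyGenTors [IsNoetherianRing Λ] {S : Set (ModuleCat.{0} Λ)}
    (hS : IsSemibrick Λ S) : IsWidelyGenTors Λ (torsClosure Λ S) := by
  have hT := isTorsionClass_torsClosure fun M hM => (hS.1 M hM).1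
  have hW := isWide_alphaOf hT
  refine ⟨hT, _, hW, Set.Subset.antisymm ?_ (torsClosure_subset hT fun M hM => hM.1)⟩
  exact torsClosure_subset (isTorsionClass_torsClosure hW.1)
    (hS.subset_alphaOf.trans (subset_torsClosure _))

theorem IsSemibrick.isWidelyGenTorf [IsArtinianRing Λ] {S : Set (ModuleCat.{0} Λ)}
    (hS : IsSemibrick Λ S) : IsWidelyGenTorf Λ (torfClosure Λ S) := by
  have hF := isTorsionFreeClass_torfClosure fun M hM => (hS.1 M hM).1
  have hW := isWide_betaOf hF
  refine ⟨hF, _, hW, Set.Subset.antisymm ?_ (torfClosure_subset hF fun M hM => hM.1)⟩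
  exact torfClosure_subset (isTorsionFreeClass_torfClosure hW.1)
    (hS.subset_betaOf.trans (subset_torfClosure _))

theorem IsWide.torsClosure_simOf [IsArtinianRing Λ] {W : Set (ModuleCat.{0} Λ)}
    (hW : IsWide Λ W) : torsClosure Λ (simOf Λ W) = torsClosure Λ W := by
  have hT := isTorsionClass_torsClosure fun M (hM : M ∈ simOf Λ W) => hW.1 M hM.1
  refine Set.Subset.antisymm ?_ (torsClosure_subset hT
    (hW.subset_of_simOf_subset_s2 hT.2.2.1 hT.2.2.2.2 (subset_torsClosure _)))
  exact torsClosure_subset (isTorsionClass_torsClosure hW.1)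
    fun M hM => subset_torsClosure W hM.1

theorem IsWide.torfClosure_simOf [IsArtinianRing Λ] {W : Set (ModuleCat.{0} Λ)}
    (hW : IsWide Λ W) : torfClosure Λ (simOf Λ W) = torfClosure Λ W := by
  have hF := isTorsionFreeClass_torfClosure fun M (hM : M ∈ simOf Λ W) => hW.1 M hM.1
  refine Set.Subset.antisymm ?_ (torfClosure_subset hF
    (hW.subset_of_simOf_subset_s2 hF.2.2.1 hF.2.2.2.2 (subset_torfClosure _)))
  exact torfClosure_subset (isTorsionFreeClass_torfClosure hW.1)
    fun M hM => subset_torfClosure W hM.1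

end Auxiliary

/-- `T ↦ MCE(T^⊥)` and `S ↦ T(S)` are mutually inverse bijections between widely
generated torsion classes and semibricks; dually `F ↦ ME(^⊥F)` and `S ↦ F(S)` are mutually inverse
bijections between widely generated torsion-free classes and semibricks. -/
theorem widelyGenerated_torsion_classes_biject_with_semibricks
    (K Λ : Type) [Field K] [Ring Λ] [Algebra K Λ] [FiniteDimensional K Λ] :
    ((∀ T, IsWidelyGenTors Λ T →
        IsSemibrick Λ (MCE Λ (rPerp Λ T)) ∧ torsClosure Λ (MCE Λ (rPerp Λ T)) = T) ∧
      (∀ S, IsSemibrick Λ S →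
        IsWidelyGenTors Λ (torsClosure Λ S) ∧ MCE Λ (rPerp Λ (torsClosure Λ S)) = S)) ∧
    ((∀ F, IsWidelyGenTorf Λ F →
        IsSemibrick Λ (ME Λ (lPerp Λ F)) ∧ torfClosure Λ (ME Λ (lPerp Λ F)) = F) ∧
      (∀ S, IsSemibrick Λ S →
        IsWidelyGenTorf Λ (torfClosure Λ S) ∧ ME Λ (lPerp Λ (torfClosure Λ S)) = S)) := by
  have : IsArtinianRing Λ := IsArtinianRing.of_finite K Λ
  refine ⟨⟨?_, fun S hS => ⟨hS.isWidelyGenTors, hS.MCE_rPerp⟩⟩,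
    ⟨?_, fun S hS => ⟨hS.isWidelyGenTorf, hS.ME_lPerp⟩⟩⟩
  · rintro T ⟨-, W, hW, rfl⟩
    rw [← hW.torsClosure_simOf, hW.isSemibrick_simOf_s2.MCE_rPerp]
    exact ⟨hW.isSemibrick_simOf_s2, rfl⟩
  · rintro F ⟨-, W, hW, rfl⟩
    rw [← hW.torfClosure_simOf, hW.isSemibrick_simOf_s2.ME_lPerp]
    exact ⟨hW.isSemibrick_simOf_s2, rfl⟩

end BrickPaper
end
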